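/- Poisson sum rule via the Nevanlinna–Pick algorithm: Let ζ ∈ 𝔻 \ {0} and let ν be a nontrivial probability measure on the unit circle 𝕋 with Schur function f. Then K(Pois(ζ) | ν) = −log(1 − |m_{conj(ζ)}(f(ζ))|²) + ∑_{k=1}^∞ −log(1 − |S_ζ^{[k]}(f)(ζ)|²), where both sides may be infinite simultaneously. -/

import Mathlib

open MeasureTheory Real Filter Set Topology Polynomial
open scoped ENNReal ComplexConjugate

noncomputable section

namespace SumRules

-- Kullback–Leibler divergence `K(ν | μ)`.
open Classical in
def KLdiv {α : Type*} [MeasurableSpace α] (ν μ : Measure α) : ℝ≥0∞ :=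
  if ν ≪ μ ∧ Integrable (llr ν μ) ν then ENNReal.ofReal (∫ x, llr ν μ x ∂ν) else ⊤

/-- The (topological) support of a measure. -/
def suppSet {α : Type*} [TopologicalSpace α] [MeasurableSpace α] (μ : Measure α) : Set α :=
  {x | ∀ U ∈ nhds x, μ U ≠ 0}

/-- A measure is nontrivial if its support is infinite, i.e. it is not carried
by any finite set. -/
def InfiniteSupport {α : Type*} [MeasurableSpace α] (μ : Measure α) : Prop :=
  ∀ s : Finset α, μ (↑s : Set α)ᶜ ≠ 0

/-- The set of support points outside `[cm, cp]`. -/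
def ES (μ : Measure ℝ) (cm cp : ℝ) : Set ℝ := suppSet μ \ Icc cm cp

/-- `μ ∈ 𝒮₁(cm, cp)`: the support of `μ` is contained in `[cm, cp]` together with an
at most countable set of points outside this interval. -/
def InS1 (μ : Measure ℝ) (cm cp : ℝ) : Prop := (ES μ cm cp).Countable

/-- `a b` (indexed so that `a (k+1) = a_{k+1}`, `b (k+1) = b_{k+1}`, `k ≥ 0`) are the Jacobi
coefficients of `μ`: there is a sequence of orthonormal polynomials (with positive leading
coefficients, obtained by Gram-Schmidt from `1, x, x², …`) satisfying the three-term recursion. -/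
def IsJacobi (μ : Measure ℝ) (a b : ℕ → ℝ) : Prop :=
  (∀ k : ℕ, 0 < a (k+1)) ∧
  ∃ p : ℕ → Polynomial ℝ,
    (∀ k, (p k).natDegree = k) ∧ (∀ k, 0 < (p k).leadingCoeff) ∧
    (∀ j k, ∫ x, (p j).eval x * (p k).eval x ∂μ = if j = k then 1 else 0) ∧
    (∀ (k : ℕ) (x : ℝ), x * (p k).eval x =
      a (k+1) * (p (k+1)).eval x + b (k+1) * (p k).eval x +
        (if k = 0 then 0 else a k * (p (k-1)).eval x))

/-- `u` is the sequence of canonical moments of a measure on `[-2,2]` (with `u 0 = -1`). -/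
def IsCanonicalMoments (μ : Measure ℝ) (u : ℕ → ℝ) : Prop :=
  u 0 = -1 ∧ (∀ k : ℕ, u (k+1) ∈ Ioo (-1 : ℝ) 1) ∧
  ∃ a b : ℕ → ℝ, IsJacobi μ a b ∧
    (∀ k : ℕ, b (k+1) = (1 - u (2*k)) * u (2*k+1) - (1 + u (2*k)) * u (2*k-1)) ∧
    (∀ k : ℕ, (a (k+1))^2 = (1 - u (2*k)) * (1 - (u (2*k+1))^2) * (1 + u (2*k+2)))

/-- `z` is the sequence of canonical coefficients of a measure supported in `[0,∞)`. -/
def IsCanonicalZ (μ : Measure ℝ) (z : ℕ → ℝ) : Prop :=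
  z 0 = 0 ∧ (∀ k : ℕ, 0 ≤ z (k+1)) ∧
  ∃ a b : ℕ → ℝ, IsJacobi μ a b ∧
    (∀ k : ℕ, b (k+1) = z (2*k) + z (2*k+1)) ∧
    (∀ k : ℕ, (a (k+1))^2 = z (2*k+1) * z (2*k+2))

def Gfun (x : ℝ) : ℝ := x - 1 - Real.log x

/-- The semicircle law. -/
def SCm : Measure ℝ :=
  volume.withDensity fun x => ENNReal.ofReal (Real.sqrt (4 - x^2) / (2*π))

/-- The arcsine law on `(-2,2)`. -/
def ArcsineM : Measure ℝ :=
  volume.withDensity fun x => ENNReal.ofReal (1 / (π * Real.sqrt (4 - x^2)))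

/-- The measure with density `(2/(π|q-p|)) √((x-p)/(q-x))` between `p` and `q`. -/
def Dmeas (p q : ℝ) : Measure ℝ :=
  volume.withDensity fun x => ENNReal.ofReal (2/(π * |q - p|) * Real.sqrt ((x - p)/(q - x)))

/-- The point `e^{iθ}` on the unit circle. -/
def ctheta (θ : ℝ) : ℂ := Complex.exp (θ * Complex.I)

/-- Reversed polynomial `Φ*` with conjugated coefficients: `Φ*(z) = z^k conj(Φ(1/conj z))`. -/
def polyStar (P : Polynomial ℂ) : Polynomial ℂ := (P.map (starRingEnd ℂ)).reverse

/-- `α` is the sequence of Verblunsky coefficients of the measure `ν` on the unit circle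
(`ν` being given in angle coordinates, carried by `[0, 2π)`): the monic orthogonal
polynomials of `ν` satisfy the Szegő recursion with coefficients `α`. -/
def IsVerblunsky (ν : Measure ℝ) (α : ℕ → ℂ) : Prop :=
  (∀ k, ‖α k‖ < 1) ∧
  ∃ Φ : ℕ → Polynomial ℂ,
    (∀ k, (Φ k).Monic) ∧ (∀ k, (Φ k).natDegree = k) ∧
    (∀ j k, j ≠ k →
      ∫ θ, conj ((Φ j).eval (ctheta θ)) * (Φ k).eval (ctheta θ) ∂ν = 0) ∧
    (∀ k, Φ (k+1) = Polynomial.X * Φ k - Polynomial.C (conj (α k)) * polyStar (Φ k))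

/-- `γ` is the sequence of deformed Verblunsky coefficients of `ν`. -/
def IsDeformedVerblunsky (ν : Measure ℝ) (γ : ℕ → ℂ) : Prop :=
  ∃ α : ℕ → ℂ, IsVerblunsky ν α ∧
    ∀ k : ℕ, γ k = conj (α k) * ∏ j ∈ Finset.range k, (1 - conj (γ j)) / (1 - γ j)

/-- Symmetry of a measure on the circle (in angle coordinates): invariance under conjugation. -/
def SymmCircle (ν : Measure ℝ) : Prop :=
  (ν.map ctheta).map (starRingEnd ℂ) = ν.map ctheta

/-- The uniform measure on the circle, in angle coordinates. -/
def UNIFm : Measure ℝ :=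
  volume.withDensity fun θ => ENNReal.ofReal (if 0 ≤ θ ∧ θ < 2*π then 1/(2*π) else 0)

end SumRules

namespace SumRules

/-- Outlier contribution for the Killip–Simon sum rule (`+∞` inside `(-2,2)`). -/
def FSC (x : ℝ) : ℝ≥0∞ :=
  if 2 ≤ |x| then
    ENNReal.ofReal (|x|/2 * Real.sqrt (x^2 - 4) - 2 * Real.log ((|x| + Real.sqrt (x^2 - 4))/2))
  else ⊤

/-- Coefficient side of the Killip–Simon sum rule. -/
def IH (a b : ℕ → ℝ) : ℝ≥0∞ :=
  (1/2 : ℝ≥0∞) * ∑' k : ℕ, ENNReal.ofReal ((b (k+1))^2)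
    + ∑' k : ℕ, ENNReal.ofReal (Gfun ((a (k+1))^2))

def tauM (τ : ℝ) : ℝ := (1 - Real.sqrt τ)^2
def tauP (τ : ℝ) : ℝ := (1 + Real.sqrt τ)^2

/-- The Marchenko–Pastur law with parameter `τ`. -/
def MPm (τ : ℝ) : Measure ℝ :=
  volume.withDensity fun x =>
    ENNReal.ofReal (Real.sqrt ((x - tauM τ) * (tauP τ - x)) / (2*π*τ*x))

/-- Outlier contribution for the Marchenko–Pastur sum rule. -/
def FMP (τ : ℝ) (x : ℝ) : ℝ≥0∞ :=
  if tauP τ ≤ x then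
    ENNReal.ofReal (∫ t in (tauP τ)..x, Real.sqrt ((t - tauP τ) * (t - tauM τ)) / (τ*t))
  else if 0 < x ∧ x ≤ tauM τ then
    ENNReal.ofReal (∫ t in x..(tauM τ), Real.sqrt ((t - tauP τ) * (t - tauM τ)) / (τ*t))
  else ⊤

/-- Coefficient side of the Marchenko–Pastur sum rule. -/
def IL (τ : ℝ) (z : ℕ → ℝ) : ℝ≥0∞ :=
  ∑' k : ℕ, ENNReal.ofReal (τ⁻¹ * Gfun (z (2*k+1)) + Gfun (τ⁻¹ * z (2*k+2)))

def uPl (κ₁ κ₂ : ℝ) : ℝ :=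
  2*(κ₂^2 - κ₁^2 + 4*Real.sqrt ((1+κ₁)*(1+κ₂)*(1+κ₁+κ₂)))/(2+κ₁+κ₂)^2
def uMi (κ₁ κ₂ : ℝ) : ℝ :=
  2*(κ₂^2 - κ₁^2 - 4*Real.sqrt ((1+κ₁)*(1+κ₂)*(1+κ₁+κ₂)))/(2+κ₁+κ₂)^2

/-- The Kesten–McKay law with parameters `κ₁, κ₂`. -/
def KMKm (κ₁ κ₂ : ℝ) : Measure ℝ :=
  volume.withDensity fun x =>
    ENNReal.ofReal ((2+κ₁+κ₂)/(2*π) * Real.sqrt ((x - uMi κ₁ κ₂) * (uPl κ₁ κ₂ - x)) / (4 - x^2))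

def ue (κ₁ κ₂ : ℝ) : ℝ := -(κ₁+κ₂)/(2+κ₁+κ₂)
def uo (κ₁ κ₂ : ℝ) : ℝ := (κ₂-κ₁)/(2+κ₁+κ₂)

def He (κ₁ κ₂ u : ℝ) : ℝ :=
  -(1+κ₁+κ₂) * Real.log ((1-u)/(1 - ue κ₁ κ₂)) - Real.log ((1+u)/(1 + ue κ₁ κ₂))
def Ho (κ₁ κ₂ u : ℝ) : ℝ :=
  -(1+κ₁) * Real.log ((1-u)/(1 - uo κ₁ κ₂)) - (1+κ₂) * Real.log ((1+u)/(1 + uo κ₁ κ₂))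

/-- Coefficient side of the Kesten–McKay sum rule. -/
def IJ (κ₁ κ₂ : ℝ) (u : ℕ → ℝ) : ℝ≥0∞ :=
  ∑' k : ℕ, (ENNReal.ofReal (Ho κ₁ κ₂ (u (2*k+1))) + ENNReal.ofReal (He κ₁ κ₂ (u (2*k+2))))

/-- Outlier contribution for the Kesten–McKay sum rule. -/
def FKMK (κ₁ κ₂ : ℝ) (x : ℝ) : ℝ≥0∞ :=
  if uPl κ₁ κ₂ ≤ x then
    ENNReal.ofReal (∫ t in (uPl κ₁ κ₂)..x,
      (2+κ₁+κ₂) * Real.sqrt ((t - uPl κ₁ κ₂) * (t - uMi κ₁ κ₂)) / (4 - t^2))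
  else if x ≤ uMi κ₁ κ₂ then
    ENNReal.ofReal (∫ t in x..(uMi κ₁ κ₂),
      (2+κ₁+κ₂) * Real.sqrt ((t - uPl κ₁ κ₂) * (t - uMi κ₁ κ₂)) / (4 - t^2))
  else ⊤

def Hgw (g : ℝ) : ℝ := 1 - Real.sqrt (1 - g^2) + Real.log ((1 + Real.sqrt (1 - g^2))/2)

def thetaG (g : ℝ) : ℝ := 2 * Real.arcsin (Real.sqrt (1/|g|))

/-- The Gross–Witten measures, in angle coordinates. -/
def GWm (g : ℝ) : Measure ℝ :=
  if |g| ≤ 1 then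
    volume.withDensity fun θ =>
      ENNReal.ofReal (if 0 ≤ θ ∧ θ < 2*π then (1 + g * Real.cos θ)/(2*π) else 0)
  else if g < -1 then
    volume.withDensity fun θ => ENNReal.ofReal (
      if π - thetaG g ≤ θ ∧ θ ≤ π + thetaG g then
        |g| / π * Real.sin (θ/2) * Real.sqrt (Real.sin (θ/2)^2 - Real.cos (thetaG g/2)^2)
      else 0)
  else
    volume.withDensity fun θ => ENNReal.ofReal (
      if -thetaG g ≤ θ ∧ θ ≤ thetaG g then
        g/π * Real.cos (θ/2) * Real.sqrt (Real.sin (thetaG g/2)^2 - Real.sin (θ/2)^2)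
      else 0)

def thetaD (d : ℝ) : ℝ := 2 * Real.arcsin (d/(1+d))
def gammaD (d : ℝ) : ℝ := -d/(1+d)

/-- The Hua–Pickrell measure, in angle coordinates. -/
def HPm (d : ℝ) : Measure ℝ :=
  volume.withDensity fun θ => ENNReal.ofReal (
    if thetaD d < θ ∧ θ < 2*π - thetaD d then
      (1+d) * Real.sqrt (Real.sin (θ/2)^2 - Real.sin (thetaD d/2)^2) / (2*π*Real.sin (θ/2))
    else 0)

/-- The entropy-like function appearing in the Hua–Pickrell sum rule. -/
def HHP (d : ℝ) (γ : ℂ) : ℝ :=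
  -Real.log ((1 - ‖γ‖^2)/(1 - (gammaD d)^2)) - 2*d*Real.log (‖1 - γ‖/(1 - gammaD d))

/-- Outlier contribution for the Hua–Pickrell sum rule (in angle coordinates). -/
def FHP (d : ℝ) (θ : ℝ) : ℝ≥0∞ :=
  if θ ≤ thetaD d then
    ENNReal.ofReal (∫ φ in θ..(thetaD d),
      (1+d) * Real.sqrt (Real.sin (thetaD d/2)^2 - Real.sin (φ/2)^2) / Real.sin (φ/2))
  else if 2*π - thetaD d ≤ θ then
    ENNReal.ofReal (∫ φ in (2*π - thetaD d)..θ,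
      (1+d) * Real.sqrt (Real.sin (thetaD d/2)^2 - Real.sin (φ/2)^2) / Real.sin (φ/2))
  else ⊤

/-- Set of outlying support points for a measure on the circle, in angle coordinates. -/
def EST (ν : Measure ℝ) (tm tp : ℝ) : Set ℝ := suppSet ν \ Icc tm tp

/-- `ν ∈ 𝒮₁^𝕋(tm, tp)` (in angle coordinates). -/
def InS1T (ν : Measure ℝ) (tm tp : ℝ) : Prop := (EST ν tm tp).Countable

/-- The measure `𝒟(2,-2)`, with density `(1/2π)√((2-x)/(2+x))` on `(-2,2)`
(a shift of the hard-edge Marchenko–Pastur law). -/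
def Dhard : Measure ℝ :=
  volume.withDensity fun x => ENNReal.ofReal (Real.sqrt ((2 - x)/(2 + x)) / (2*π))

/-- The mixture `μ_g = |g| 𝒟(2,-2) + (1-|g|) Arcsine`. -/
def mugMix (g : ℝ) : Measure ℝ :=
  ENNReal.ofReal |g| • Dhard + ENNReal.ofReal (1 - |g|) • ArcsineM

/-- The mixture `ρ_g = |g| SC + (1-|g|) Arcsine`. -/
def rhog (g : ℝ) : Measure ℝ :=
  ENNReal.ofReal |g| • SCm + ENNReal.ofReal (1 - |g|) • ArcsineM

def Cg (g : ℝ) : ℝ :=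
  -|g| * (1 - Real.log 2) + 1 - Real.sqrt (1 - g^2) + Real.log ((1 + Real.sqrt (1 - g^2))/2)

/-- The measure with density `(1/2π)(2+x)^{3/2}(2-x)^{1/2}` on `[-2,2]`. -/
def muHat : Measure ℝ :=
  volume.withDensity fun x =>
    ENNReal.ofReal ((2 + x) * Real.sqrt (2 + x) * Real.sqrt (2 - x) / (2*π))

/-- The Poisson kernel measure `Pois(ζ)`, in angle coordinates. -/
def PoisM (ζ : ℂ) : Measure ℝ :=
  volume.withDensity fun θ => ENNReal.ofReal (
    if 0 ≤ θ ∧ θ < 2*π then (1 - ‖ζ‖^2)/(2*π*‖ctheta θ - ζ‖^2) else 0)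

/-- The Carathéodory function of a measure on the circle (angle coordinates). -/
def Cara (ν : Measure ℝ) (z : ℂ) : ℂ := ∫ θ, (ctheta θ + z)/(ctheta θ - z) ∂ν

/-- `f` is the Schur function of `ν`. -/
def IsSchurFn (ν : Measure ℝ) (f : ℂ → ℂ) : Prop :=
  DifferentiableOn ℂ f (Metric.ball 0 1) ∧
  (∀ z ∈ Metric.ball (0:ℂ) 1, ‖f z‖ ≤ 1) ∧
  (∀ z ∈ Metric.ball (0:ℂ) 1, Cara ν z - 1 = z * f z * (Cara ν z + 1))

/-- Möbius transform of the unit disk. -/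
def mtrans (ρ z : ℂ) : ℂ := (z - ρ)/(1 - conj ρ * z)

def npRaw (ρ : ℂ) (g : ℂ → ℂ) (z : ℂ) : ℂ :=
  ((-ρ/(‖ρ‖ : ℂ)) / mtrans ρ z) * ((g z - g ρ)/(1 - conj (g ρ) * g z))

-- One step of the Nevanlinna–Pick algorithm at `ρ` (the removable singularity at `ρ`
-- is filled in by the limit).
open Classical in
def npStep (ρ : ℂ) (g : ℂ → ℂ) : ℂ → ℂ := fun z =>
  if z = ρ then limUnder (𝓝[≠] ρ) (npRaw ρ g) else npRaw ρ g z

def schurRaw (g : ℂ → ℂ) (z : ℂ) : ℂ := ((g z - g 0)/z)/(1 - conj (g 0) * g z)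

-- One step of the classical Schur algorithm (the removable singularity at `0`
-- is filled in by the limit).
open Classical in
def schurStep (g : ℂ → ℂ) : ℂ → ℂ := fun z =>
  if z = 0 then limUnder (𝓝[≠] (0:ℂ)) (schurRaw g) else schurRaw g z

def xdHP (d : ℝ) : ℝ := 2*(1 + 2*d - d^2)/(1+d)^2

def uKMK (d : ℝ) : ℝ := 2*Real.sqrt (1 + 2*d)/(1+d)

end SumRules

namespace SumRules

lemma norm_ctheta (θ : ℝ) : ‖ctheta θ‖ = 1 := by
  simp [ctheta, Complex.norm_exp_ofReal_mul_I]

lemma continuous_ctheta : Continuous ctheta := by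
  unfold ctheta; fun_prop

/-- Poisson kernel. -/
def pk (z : ℂ) (θ : ℝ) : ℝ := (1 - ‖z‖^2) / ‖ctheta θ - z‖^2

/-- normalized Lebesgue measure on the angles -/
def lam : Measure ℝ := ENNReal.ofReal (2*π)⁻¹ • volume.restrict (Ico 0 (2*π))

instance : IsProbabilityMeasure lam := by
  constructor
  simp only [lam, Measure.smul_apply, Measure.restrict_apply MeasurableSet.univ, univ_inter,
    Real.volume_Ico, sub_zero, smul_eq_mul]
  rw [← ENNReal.ofReal_mul (by positivity), inv_mul_cancel₀ (by positivity), ENNReal.ofReal_one]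

lemma circleAverage_eq {E : Type*} [NormedAddCommGroup E] [NormedSpace ℝ E] (g : ℂ → E) (r : ℝ) :
    circleAverage g 0 r = ∫ t, g (r * ctheta t) ∂lam := by
  rw [circleAverage_def, lam, integral_smul_measure, intervalIntegral.integral_of_le (by positivity),
    ENNReal.toReal_ofReal (by positivity), restrict_Ico_eq_restrict_Ioc]
  simp [circleMap, ctheta]

lemma ctheta_sub_ne {z : ℂ} (hz : ‖z‖ < 1) (θ : ℝ) : ctheta θ - z ≠ 0 := by
  intro h
  have := norm_ctheta θ
  rw [sub_eq_zero.1 h] at this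
  linarith

lemma pk_pos {z : ℂ} (hz : ‖z‖ < 1) (θ : ℝ) : 0 < pk z θ := by
  have h := norm_pos_iff.2 (ctheta_sub_ne hz θ)
  have : 0 < 1 - ‖z‖^2 := by nlinarith [norm_nonneg z]
  unfold pk; positivity

lemma norm_ctheta_sub_ge (z : ℂ) (θ : ℝ) : 1 - ‖z‖ ≤ ‖ctheta θ - z‖ := by
  have := norm_sub_norm_le (ctheta θ) z
  rwa [norm_ctheta] at this

lemma pk_le {z : ℂ} (hz : ‖z‖ < 1) (θ : ℝ) : pk z θ ≤ 2 / (1 - ‖z‖) := by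
  have h1 := norm_ctheta_sub_ge z θ
  have h2 : 0 < 1 - ‖z‖ := by linarith
  unfold pk
  rw [div_le_div_iff₀ (by nlinarith) h2]
  have h3 : (1 - ‖z‖)^2 ≤ ‖ctheta θ - z‖^2 := by gcongr
  have h4 : (1 - ‖z‖ ^ 2) * (1 - ‖z‖) = (1 - ‖z‖)^2 * (1 + ‖z‖) := by ring
  rw [h4]
  nlinarith [norm_nonneg z, sq_nonneg (1 - ‖z‖)]

lemma pk_eq_re (z : ℂ) (θ : ℝ) : pk z θ = ((ctheta θ + z)/(ctheta θ - z)).re := by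
  have h1 : (ctheta θ).re^2 + (ctheta θ).im^2 = 1 := by
    have := norm_ctheta θ
    rw [← Complex.normSq_add_mul_I, Complex.re_add_im, Complex.normSq_eq_norm_sq, this, one_pow]
  rw [pk, Complex.div_re, ← Complex.normSq_eq_norm_sq, ← Complex.normSq_eq_norm_sq, ← add_div]
  congr 1
  rw [Complex.normSq_apply]
  simp only [Complex.add_re, Complex.add_im, Complex.sub_re, Complex.sub_im]
  linarith

lemma continuous_pk {z : ℂ} (hz : ‖z‖ < 1) : Continuous (pk z) := by
  unfold pk
  refine Continuous.div continuous_const (by have := continuous_ctheta; fun_prop) fun θ => ?_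
  exact pow_ne_zero _ (norm_ne_zero_iff.2 (ctheta_sub_ne hz θ))

lemma measurable_pk_comp {g : ℝ × ℝ → ℂ} (hg : Measurable g) :
    Measurable (fun q : ℝ × ℝ => pk (g q) q.1) := by
  unfold pk
  have h2 : Measurable fun q : ℝ × ℝ => ctheta q.1 := continuous_ctheta.measurable.comp measurable_fst
  exact (measurable_const.sub (hg.norm.pow_const 2)).div ((h2.sub hg).norm.pow_const 2)

lemma integral_pk {z : ℂ} (hz : ‖z‖ < 1) : ∫ θ, pk z θ ∂lam = 1 := by
  have hc : Continuous fun θ => (ctheta θ + z)/(ctheta θ - z) :=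
    Continuous.div (by have := continuous_ctheta; fun_prop)
      (by have := continuous_ctheta; fun_prop) fun θ => ctheta_sub_ne hz θ
  have hb : ∀ θ, ‖(ctheta θ + z)/(ctheta θ - z)‖ ≤ 2/(1 - ‖z‖) := fun θ => by
    rw [norm_div]
    have h1 := norm_ctheta_sub_ge z θ
    have h2 := norm_add_le (ctheta θ) z
    rw [norm_ctheta] at h2
    gcongr <;> linarith
  have hi : Integrable (fun θ => (ctheta θ + z)/(ctheta θ - z)) lam :=
    Integrable.of_bound hc.aestronglyMeasurable _ (Eventually.of_forall hb)
  have : ∫ θ, (ctheta θ + z)/(ctheta θ - z) ∂lam = 1 := by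
    have h := circleAverage_eq (fun w => (w+z)/(w-z)) 1
    simp only [Complex.ofReal_one, one_mul] at h
    rw [← h, circleAverage_eq_circleIntegral one_ne_zero]
    have e : ∀ w ∈ Metric.sphere (0:ℂ) 1, (w - 0)⁻¹ • ((w+z)/(w-z)) = 2 * (w - z)⁻¹ - (w - 0)⁻¹ := by
      intro w hw
      have hw1 : ‖w‖ = 1 := by simpa using hw
      have hw0 : w ≠ 0 := by rintro rfl; simp at hw1
      have hwz : w - z ≠ 0 := by
        intro h; rw [sub_eq_zero] at h; rw [h] at hw1; linarith
      simp only [sub_zero, smul_eq_mul]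
      field_simp
      ring
    rw [circleIntegral.integral_congr zero_le_one e, circleIntegral.integral_sub,
      circleIntegral.integral_const_mul,
      circleIntegral.integral_sub_inv_of_mem_ball (by simpa using hz),
      circleIntegral.integral_sub_inv_of_mem_ball (by simp)]
    · have : (π:ℂ) ≠ 0 := by exact_mod_cast Real.pi_ne_zero
      simp
      field_simp
      norm_num
    · apply ContinuousOn.circleIntegrable zero_le_one
      refine ContinuousOn.mul continuousOn_const (ContinuousOn.inv₀ (by fun_prop) ?_)
      intro w hw h
      have hw1 : ‖w‖ = 1 := by simpa using hw
      rw [sub_eq_zero] at h; rw [h] at hw1; linarith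
    · apply ContinuousOn.circleIntegrable zero_le_one
      refine (ContinuousOn.inv₀ (by fun_prop) ?_)
      intro w hw h
      have hw1 : ‖w‖ = 1 := by simpa using hw
      rw [sub_eq_zero] at h; rw [h] at hw1; simp at hw1
  have h2 := integral_re hi
  simp only [pk_eq_re]
  have h3 := congrArg Complex.re this
  simp only [Complex.one_re] at h3
  rw [← h3]
  exact h2

lemma PoisM_eq (ζ : ℂ) (hζ : ‖ζ‖ < 1) :
    PoisM ζ = lam.withDensity fun θ => ENNReal.ofReal (pk ζ θ) := by
  have hm : Measurable fun θ => ENNReal.ofReal (pk ζ θ) := (continuous_pk hζ).measurable.ennreal_ofReal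
  rw [lam, withDensity_smul_measure, ← withDensity_indicator measurableSet_Ico,
    ← withDensity_smul _ (hm.indicator measurableSet_Ico), PoisM]
  congr 1
  ext θ
  by_cases h : θ ∈ Ico 0 (2*π)
  · simp only [Pi.smul_apply, indicator_of_mem h, smul_eq_mul]
    rw [if_pos (by simpa using h), ← ENNReal.ofReal_mul (by positivity), pk]
    congr 1
    field_simp
  · simp only [Pi.smul_apply, indicator_of_notMem h]
    rw [if_neg (by simpa using h)]; simp

lemma integral_PoisM {ζ : ℂ} (hζ : ‖ζ‖ < 1) (g : ℝ → ℝ) :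
    ∫ θ, g θ ∂(PoisM ζ) = ∫ θ, g θ * pk ζ θ ∂lam := by
  rw [PoisM_eq ζ hζ, integral_withDensity_eq_integral_toReal_smul
    (continuous_pk hζ).measurable.ennreal_ofReal (by simp)]
  refine integral_congr_ae (Eventually.of_forall fun θ => ?_)
  simp only [smul_eq_mul]
  rw [ENNReal.toReal_ofReal (pk_pos hζ θ).le, mul_comm]

lemma isProb_PoisM {ζ : ℂ} (hζ : ‖ζ‖ < 1) : IsProbabilityMeasure (PoisM ζ) := by
  constructor
  rw [PoisM_eq ζ hζ, withDensity_apply _ MeasurableSet.univ, Measure.restrict_univ,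
    ← ofReal_integral_eq_lintegral_ofReal, integral_pk hζ, ENNReal.ofReal_one]
  · exact Integrable.of_bound (continuous_pk hζ).aestronglyMeasurable (2/(1-‖ζ‖))
      (Eventually.of_forall fun θ => by
        rw [Real.norm_of_nonneg (pk_pos hζ θ).le]; exact pk_le hζ θ)
  · exact Eventually.of_forall fun θ => (pk_pos hζ θ).le

lemma lam_compl : lam (Ico 0 (2*π))ᶜ = 0 := by
  simp [lam, Measure.restrict_apply measurableSet_Ico.compl]

lemma norm_mob (a b : ℂ) :
    ‖1 - conj a * b‖^2 - ‖b - a‖^2 = (1 - ‖a‖^2) * (1 - ‖b‖^2) := by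
  simp only [← Complex.normSq_eq_norm_sq, Complex.normSq_apply]
  simp
  ring

lemma one_sub_ne {a b : ℂ} (h : ‖a‖ < 1) (hb : ‖b‖ ≤ 1) : 1 - conj a * b ≠ 0 := by
  intro h0
  have h1 : ‖conj a * b‖ = 1 := by rw [← sub_eq_zero.1 h0, norm_one]
  rw [norm_mul, RCLike.norm_conj] at h1
  nlinarith [norm_nonneg a, norm_nonneg b]

/-- inverse Moebius map -/
def Tm (ζ w : ℂ) : ℂ := (w + ζ) / (1 + conj ζ * w)

lemma Tm_eq (ζ w : ℂ) : Tm ζ w = (w - (-ζ)) / (1 - conj (-ζ) * w) := by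
  simp [Tm]

lemma Tden_ne {ζ w : ℂ} (h : ‖ζ‖ < 1) (hw : ‖w‖ ≤ 1) : 1 + conj ζ * w ≠ 0 := by
  have := one_sub_ne (a := -ζ) (b := w) (by simpa using h) hw
  simpa using this

lemma Tm_zero (ζ : ℂ) : Tm ζ 0 = ζ := by simp [Tm]

lemma one_sub_Tm {ζ w : ℂ} (h : ‖ζ‖ < 1) (hw : ‖w‖ ≤ 1) :
    1 - ‖Tm ζ w‖^2 = (1 - ‖ζ‖^2) * (1 - ‖w‖^2) / ‖1 + conj ζ * w‖^2 := by
  have h1 := norm_mob (-ζ) w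
  have h2 := norm_ne_zero_iff.2 (Tden_ne h hw)
  simp only [map_neg, neg_mul, sub_neg_eq_add, norm_neg] at h1
  rw [← h1, Tm, norm_div, div_pow, one_sub_div (pow_ne_zero 2 h2)]

lemma norm_Tm_lt {ζ w : ℂ} (h : ‖ζ‖ < 1) (hw : ‖w‖ < 1) : ‖Tm ζ w‖ < 1 := by
  have h1 := one_sub_Tm h hw.le
  have h2 := norm_pos_iff.2 (Tden_ne h hw.le)
  have h3 : 0 < 1 - ‖ζ‖^2 := by nlinarith [norm_nonneg ζ]
  have h4 : 0 < 1 - ‖w‖^2 := by nlinarith [norm_nonneg w]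
  have h5 : 0 < 1 - ‖Tm ζ w‖^2 := by rw [h1]; positivity
  nlinarith [norm_nonneg (Tm ζ w)]

lemma diff_Tm {ζ : ℂ} (h : ‖ζ‖ < 1) : DifferentiableOn ℂ (Tm ζ) (Metric.ball 0 1) := by
  unfold Tm
  refine DifferentiableOn.div (by fun_prop) (by fun_prop) fun w hw => Tden_ne h ?_
  have : ‖w‖ < 1 := by simpa using hw
  exact this.le

lemma mtrans_Tm {ζ w : ℂ} (h : ‖ζ‖ < 1) (hw : ‖w‖ < 1) : mtrans ζ (Tm ζ w) = w := by
  have h2 := Tden_ne h hw.le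
  have h3 : 1 - conj ζ * Tm ζ w ≠ 0 := one_sub_ne h (norm_Tm_lt h hw).le
  rw [mtrans, div_eq_iff h3, Tm]
  have h2' := h2
  rw [mul_comm (conj ζ) w] at h2'
  field_simp
  ring

lemma Tm_mtrans {ζ z : ℂ} (h : ‖ζ‖ < 1) (hz : ‖z‖ < 1) : Tm ζ (mtrans ζ z) = z := by
  have h1 : mtrans ζ z = Tm (-ζ) z := by simp [mtrans, Tm_eq]
  have h1' : ‖mtrans ζ z‖ < 1 := by rw [h1]; exact norm_Tm_lt (by simpa using h) hz
  have h2 := Tden_ne h h1'.le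
  have h3 : 1 - conj ζ * z ≠ 0 := one_sub_ne h hz.le
  rw [Tm, div_eq_iff h2]
  rw [mtrans]
  have h3' := h3
  rw [mul_comm (conj ζ) z] at h3'
  field_simp
  ring

lemma norm_mtrans_lt {ζ z : ℂ} (h : ‖ζ‖ < 1) (hz : ‖z‖ < 1) : ‖mtrans ζ z‖ < 1 := by
  have h1 : mtrans ζ z = Tm (-ζ) z := by simp [mtrans, Tm_eq]
  rw [h1]; exact norm_Tm_lt (by simpa using h) hz

/-- Points on the hyperbolic circle around `ζ`. -/
def Zr (ζ : ℂ) (r t : ℝ) : ℂ := Tm ζ (r * ctheta t)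

lemma norm_rc {r : ℝ} (hr : 0 ≤ r) (t : ℝ) : ‖(r:ℂ) * ctheta t‖ = r := by
  rw [norm_mul, norm_ctheta, mul_one, Complex.norm_real, Real.norm_of_nonneg hr]

lemma Zr_lt {ζ : ℂ} (h : ‖ζ‖ < 1) {r : ℝ} (hr : 0 ≤ r) (hr1 : r < 1) (t : ℝ) : ‖Zr ζ r t‖ < 1 :=
  norm_Tm_lt h (by rw [norm_rc hr]; exact hr1)

lemma mtrans_Zr {ζ : ℂ} (h : ‖ζ‖ < 1) {r : ℝ} (hr : 0 ≤ r) (hr1 : r < 1) (t : ℝ) :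
    ‖mtrans ζ (Zr ζ r t)‖ = r := by
  rw [Zr, mtrans_Tm h (by rw [norm_rc hr]; exact hr1), norm_rc hr]

lemma continuous_Zr {ζ : ℂ} (h : ‖ζ‖ < 1) {r : ℝ} (hr : 0 ≤ r) (hr1 : r < 1) :
    Continuous (Zr ζ r) := by
  unfold Zr
  refine (diff_Tm h).continuousOn.comp_continuous (by have := continuous_ctheta; fun_prop) fun t => ?_
  simp only [Metric.mem_ball, dist_zero_right]
  rw [norm_rc hr]; exact hr1

lemma one_sub_Zr {ζ : ℂ} (h : ‖ζ‖ < 1) {r : ℝ} (hr : 0 ≤ r) (hr1 : r < 1) (t : ℝ) :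
    1 - ‖Zr ζ r t‖^2 ≤ (1 - ‖ζ‖)⁻¹^2 * (1 - r^2) := by
  have h0 := norm_rc hr t
  rw [Zr, one_sub_Tm h (by rw [h0]; exact hr1.le), h0]
  have h1 : 1 - ‖ζ‖ ≤ ‖1 + conj ζ * (r * ctheta t)‖ := by
    have := norm_sub_norm_le (1:ℂ) (-(conj ζ * (r * ctheta t)))
    rw [norm_neg, norm_mul, h0, RCLike.norm_conj, norm_one, sub_neg_eq_add] at this
    nlinarith [norm_nonneg ζ]
  have h2 : 0 < 1 - ‖ζ‖ := by linarith
  have h3 : 0 ≤ 1 - r^2 := by nlinarith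
  rw [inv_pow, inv_mul_eq_div]
  gcongr
  nlinarith [sq_nonneg ‖ζ‖]

/-- mean value property -/
lemma mean_Zr {ζ : ℂ} (h : ‖ζ‖ < 1) {r : ℝ} (hr : 0 ≤ r) (hr1 : r < 1) {g : ℂ → ℂ}
    (hg : DifferentiableOn ℂ g (Metric.ball 0 1)) :
    ∫ t, g (Zr ζ r t) ∂lam = g ζ := by
  have h1 := circleAverage_eq (fun w => g (Tm ζ w)) r
  have hd : DifferentiableOn ℂ (fun w => g (Tm ζ w)) (Metric.ball 0 1) :=
    hg.comp (diff_Tm h) fun w hw => by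
      simp only [Metric.mem_ball, dist_zero_right] at hw ⊢
      exact norm_Tm_lt h hw
  have h2 : DiffContOnCl ℂ (fun w => g (Tm ζ w)) (Metric.ball 0 |r|) := by
    apply DifferentiableOn.diffContOnCl
    refine hd.mono (Metric.closure_ball_subset_closedBall.trans ?_)
    apply Metric.closedBall_subset_ball
    rwa [abs_of_nonneg hr]
  rw [h2.circleAverage, Tm_zero] at h1
  exact h1.symm

lemma int_lam {E : Type*} [NormedAddCommGroup E] {u : ℝ → E} (hu : Continuous u) : Integrable u lam := by
  unfold lam
  refine Integrable.smul_measure ?_ (by simp)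
  exact (hu.continuousOn.integrableOn_compact (isCompact_Icc (a := 0) (b := 2*π))).mono_set
    Ico_subset_Icc_self

lemma cont_Zr {E : Type*} [TopologicalSpace E] {ζ : ℂ} (h : ‖ζ‖ < 1) {r : ℝ} (hr : 0 ≤ r) (hr1 : r < 1)
    {g : ℂ → E} (hg : ContinuousOn g (Metric.ball 0 1)) : Continuous fun t => g (Zr ζ r t) :=
  hg.comp_continuous (continuous_Zr h hr hr1) fun t => by
    simpa using Zr_lt h hr hr1 t

lemma int_Zr {E : Type*} [NormedAddCommGroup E] {ζ : ℂ} (h : ‖ζ‖ < 1) {r : ℝ} (hr : 0 ≤ r) (hr1 : r < 1)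
    {g : ℂ → E} (hg : ContinuousOn g (Metric.ball 0 1)) : Integrable (fun t => g (Zr ζ r t)) lam :=
  int_lam (cont_Zr h hr hr1 hg)

lemma mean_Zr_re {ζ : ℂ} (h : ‖ζ‖ < 1) {r : ℝ} (hr : 0 ≤ r) (hr1 : r < 1) {g : ℂ → ℂ}
    (hg : DifferentiableOn ℂ g (Metric.ball 0 1)) :
    ∫ t, (g (Zr ζ r t)).re ∂lam = (g ζ).re := by
  rw [← mean_Zr h hr hr1 hg]
  exact integral_re (int_Zr h hr hr1 hg.continuousOn)

/-- mean value property for `log ‖g‖` -/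
lemma mean_Zr_log {ζ : ℂ} (h : ‖ζ‖ < 1) {r : ℝ} (hr : 0 ≤ r) (hr1 : r < 1) {g : ℂ → ℂ}
    (hg : DifferentiableOn ℂ g (Metric.ball 0 1)) (hp : ∀ z ∈ Metric.ball (0:ℂ) 1, 0 < (g z).re) :
    ∫ t, Real.log ‖g (Zr ζ r t)‖ ∂lam = Real.log ‖g ζ‖ := by
  have := mean_Zr_re h hr hr1 (g := fun z => Complex.log (g z))
    (hg.clog fun z hz => Or.inl (hp z hz))
  simpa only [Complex.log_re] using this

lemma diff_herg (θ : ℝ) :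
    DifferentiableOn ℂ (fun z => (ctheta θ + z)/(ctheta θ - z)) (Metric.ball 0 1) := by
  refine DifferentiableOn.div (by fun_prop) (by fun_prop) fun z hz => ctheta_sub_ne (by simpa using hz) θ

lemma mean_pk {ζ : ℂ} (h : ‖ζ‖ < 1) {r : ℝ} (hr : 0 ≤ r) (hr1 : r < 1) (θ : ℝ) :
    ∫ t, pk (Zr ζ r t) θ ∂lam = pk ζ θ := by
  simp only [pk_eq_re]
  exact mean_Zr_re h hr hr1 (diff_herg θ)

lemma contOn_pk (θ : ℝ) : ContinuousOn (fun z => pk z θ) (Metric.ball 0 1) := by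
  simp only [pk_eq_re]
  exact Complex.continuous_re.comp_continuousOn (diff_herg θ).continuousOn

lemma cara_re (ν : Measure ℝ) [IsProbabilityMeasure ν] {z : ℂ} (hz : ‖z‖ < 1) :
    (Cara ν z).re = ∫ θ, pk z θ ∂ν := by
  have hc : Continuous fun θ => (ctheta θ + z)/(ctheta θ - z) :=
    Continuous.div (by have := continuous_ctheta; fun_prop)
      (by have := continuous_ctheta; fun_prop) fun θ => ctheta_sub_ne hz θ
  have hb : ∀ θ, ‖(ctheta θ + z)/(ctheta θ - z)‖ ≤ 2/(1 - ‖z‖) := fun θ => by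
    rw [norm_div]
    have h1 := norm_ctheta_sub_ge z θ
    have h2 := norm_add_le (ctheta θ) z
    rw [norm_ctheta] at h2
    gcongr <;> linarith
  have hi : Integrable (fun θ => (ctheta θ + z)/(ctheta θ - z)) ν :=
    Integrable.of_bound hc.aestronglyMeasurable _ (Eventually.of_forall hb)
  simp only [pk_eq_re]
  exact (integral_re hi).symm

lemma int_pk (ν : Measure ℝ) [IsFiniteMeasure ν] {z : ℂ} (hz : ‖z‖ < 1) : Integrable (pk z) ν :=
  Integrable.of_bound (continuous_pk hz).aestronglyMeasurable (2/(1-‖z‖))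
      (Eventually.of_forall fun θ => by
        rw [Real.norm_of_nonneg (pk_pos hz θ).le]; exact pk_le hz θ)

lemma cara_re_pos (ν : Measure ℝ) [IsProbabilityMeasure ν] {z : ℂ} (hz : ‖z‖ < 1) :
    0 < (Cara ν z).re := by
  rw [cara_re ν hz, integral_pos_iff_support_of_nonneg (fun θ => (pk_pos hz θ).le) (int_pk ν hz)]
  have : Function.support (pk z) = univ := by
    ext θ; simp [(pk_pos hz θ).ne']
  simp [this]

lemma Zr_bound {ζ : ℂ} (h : ‖ζ‖ < 1) {r : ℝ} (hr : 0 ≤ r) (hr1 : r < 1) :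
    ∃ ρ < 1, ∀ t, ‖Zr ζ r t‖ ≤ ρ := by
  have hc : ContinuousOn (fun w => ‖Tm ζ w‖) (Metric.closedBall 0 r) := by
    apply ((diff_Tm h).continuousOn.mono _).norm
    exact Metric.closedBall_subset_ball hr1
  obtain ⟨w, hw, hm⟩ := (isCompact_closedBall (0:ℂ) r).exists_isMaxOn ⟨0, by simpa using hr⟩ hc
  refine ⟨‖Tm ζ w‖, norm_Tm_lt h ?_, fun t => ?_⟩
  · have : ‖w‖ ≤ r := by simpa using hw
    linarith
  · apply hm
    simpa using (norm_rc hr t).le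

lemma fub_int {ζ : ℂ} (h : ‖ζ‖ < 1) {r : ℝ} (hr : 0 ≤ r) (hr1 : r < 1)
    (ν : Measure ℝ) [IsFiniteMeasure ν] {H : ℝ → ℝ} (hH : Integrable H ν) {χ : ℂ → ℝ}
    (hχ : ContinuousOn χ (Metric.closedBall 0 1)) :
    Integrable (fun q : ℝ × ℝ => H q.1 * (χ (Zr ζ r q.2) * pk (Zr ζ r q.2) q.1)) (ν.prod lam) := by
  obtain ⟨ρ, hρ, hb⟩ := Zr_bound h hr hr1
  obtain ⟨C, hC⟩ := (isCompact_closedBall (0:ℂ) 1).exists_bound_of_continuousOn hχ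
  have hZ := continuous_Zr h hr hr1
  have hχZ : Continuous fun t => χ (Zr ζ r t) := by
    refine hχ.comp_continuous hZ fun t => ?_
    simpa using (Zr_lt h hr hr1 t).le
  have h1 : Integrable (fun q : ℝ × ℝ => H q.1) (ν.prod lam) := hH.comp_fst lam
  have hm1 : Measurable (fun q : ℝ × ℝ => χ (Zr ζ r q.2)) := hχZ.measurable.comp measurable_snd
  have hm2 : Measurable (fun q : ℝ × ℝ => Zr ζ r q.2) := hZ.measurable.comp measurable_snd
  have hm3 : Measurable (fun q : ℝ × ℝ => pk (Zr ζ r q.2) q.1) := measurable_pk_comp hm2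
  have hm4 : Measurable (fun q : ℝ × ℝ => χ (Zr ζ r q.2) * pk (Zr ζ r q.2) q.1) := hm1.mul hm3
  have hbd : ∀ q : ℝ × ℝ, ‖χ (Zr ζ r q.2) * pk (Zr ζ r q.2) q.1‖ ≤ C * (2/(1-ρ)) := fun q => by
    have hz := Zr_lt h hr hr1 q.2
    rw [norm_mul, Real.norm_of_nonneg (pk_pos hz q.1).le]
    have h2 := pk_le hz q.1
    have h3 : 2/(1 - ‖Zr ζ r q.2‖) ≤ 2/(1-ρ) := by
      have := hb q.2
      gcongr
    have h4 := hC (Zr ζ r q.2) (by simpa using hz.le)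
    have h5 := (norm_nonneg _).trans h4
    exact mul_le_mul h4 (h2.trans h3) (pk_pos hz q.1).le h5
  exact h1.mul_bdd hm4.aestronglyMeasurable (Eventually.of_forall hbd)

/-- Fubini -/
lemma fub {ζ : ℂ} (h : ‖ζ‖ < 1) {r : ℝ} (hr : 0 ≤ r) (hr1 : r < 1)
    (ν : Measure ℝ) [IsFiniteMeasure ν] {H : ℝ → ℝ} (hH : Integrable H ν) {χ : ℂ → ℝ}
    (hχ : ContinuousOn χ (Metric.closedBall 0 1)) :
    ∫ t, χ (Zr ζ r t) * ∫ θ, H θ * pk (Zr ζ r t) θ ∂ν ∂lam =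
      ∫ θ, H θ * ∫ t, χ (Zr ζ r t) * pk (Zr ζ r t) θ ∂lam ∂ν := by
  have := integral_integral_swap (f := fun θ t => H θ * (χ (Zr ζ r t) * pk (Zr ζ r t) θ))
    (fub_int h hr hr1 ν hH hχ)
  simp only [← integral_const_mul]
  rw [this]
  refine integral_congr_ae (Eventually.of_forall fun t => integral_congr_ae (Eventually.of_forall fun θ => ?_))
  simp only
  ring

lemma conc {ζ : ℂ} (h : ‖ζ‖ < 1) {χ : ℂ → ℝ}
    (hχ : ContinuousOn χ (Metric.closedBall 0 1)) (θ : ℝ) :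
    Tendsto (fun r => ∫ t, χ (Zr ζ r t) * pk (Zr ζ r t) θ ∂lam) (𝓝[<] 1)
      (𝓝 (χ (ctheta θ) * pk ζ θ)) := by
  obtain ⟨C, hC⟩ := (isCompact_closedBall (0:ℂ) 1).exists_bound_of_continuousOn hχ
  have hθ1 : ctheta θ ∈ Metric.closedBall (0:ℂ) 1 := by simp [norm_ctheta]
  have hC0 : 0 ≤ C := (norm_nonneg _).trans (hC _ hθ1)
  have hp := pk_pos h θ
  rw [Metric.tendsto_nhds]
  intro ε hε
  obtain ⟨δ, hδ, hδ'⟩ := Metric.continuousOn_iff.1 hχ _ hθ1 (ε/2/pk ζ θ) (by positivity)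
  set M := 2 * C * ((1 - ‖ζ‖)⁻¹^2 / δ^2) with hM
  have hlim : Tendsto (fun r : ℝ => M * (1 - r^2)) (𝓝[<] 1) (𝓝 0) := by
    have : Tendsto (fun r : ℝ => M * (1 - r^2)) (𝓝 1) (𝓝 (M * (1 - 1^2))) :=
      (by fun_prop : Continuous (fun r : ℝ => M * (1 - r^2))).tendsto 1
    simp only [one_pow, sub_self, mul_zero] at this
    exact this.mono_left nhdsWithin_le_nhds
  have h1 : ∀ᶠ r : ℝ in 𝓝[<] 1, M * (1 - r^2) < ε/2 := hlim.eventually_lt_const (by positivity)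
  have h2 : ∀ᶠ r : ℝ in 𝓝[<] 1, r ∈ Ioo (0:ℝ) 1 := Ioo_mem_nhdsLT zero_lt_one
  filter_upwards [h1, h2] with r hr ⟨hr0, hr1⟩
  have hχZ : Continuous fun t => χ (Zr ζ r t) :=
    cont_Zr h hr0.le hr1 (hχ.mono Metric.ball_subset_closedBall)
  have hpZ : Continuous fun t => pk (Zr ζ r t) θ := cont_Zr h hr0.le hr1 (contOn_pk θ)
  have hI1 : Integrable (fun t => χ (Zr ζ r t) * pk (Zr ζ r t) θ) lam := int_lam (hχZ.mul hpZ)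
  have hI2 : ∀ c : ℝ, Integrable (fun t => c * pk (Zr ζ r t) θ) lam := fun c =>
    (int_lam hpZ).const_mul c
  rw [Real.dist_eq]
  have e0 : χ (ctheta θ) * pk ζ θ = ∫ t, χ (ctheta θ) * pk (Zr ζ r t) θ ∂lam := by
    rw [integral_const_mul, mean_pk h hr0.le hr1 θ]
  rw [e0, ← integral_sub hI1 (hI2 _)]
  have key : ∀ t, ‖χ (Zr ζ r t) * pk (Zr ζ r t) θ - χ (ctheta θ) * pk (Zr ζ r t) θ‖
      ≤ ε/2/pk ζ θ * pk (Zr ζ r t) θ + M * (1 - r^2) := by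
    intro t
    have hz := Zr_lt h hr0.le hr1 t
    have hzc : Zr ζ r t ∈ Metric.closedBall (0:ℂ) 1 := by simpa using hz.le
    have hpp := pk_pos hz θ
    have hr2 : 0 ≤ 1 - r^2 := by nlinarith
    rw [← sub_mul, norm_mul, Real.norm_of_nonneg hpp.le]
    by_cases hd : dist (Zr ζ r t) (ctheta θ) < δ
    · have := (hδ' _ hzc hd).le
      rw [Real.dist_eq] at this
      have h3 : 0 ≤ M * (1 - r^2) := by positivity
      have h4 := mul_le_mul_of_nonneg_right this hpp.le
      rw [Real.norm_eq_abs]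
      linarith
    · push Not at hd
      have h3 : pk (Zr ζ r t) θ ≤ ((1 - ‖ζ‖)⁻¹^2 / δ^2) * (1 - r^2) := by
        rw [div_mul_eq_mul_div, pk]
        rw [dist_comm, dist_eq_norm] at hd
        have h5 := one_sub_Zr h hr0.le hr1 t
        gcongr
      have h4 : ‖χ (Zr ζ r t) - χ (ctheta θ)‖ ≤ 2 * C := by
        refine (norm_sub_le _ _).trans ?_
        linarith [hC _ hzc, hC _ hθ1]
      have h5 : 0 ≤ ε/2/pk ζ θ * pk (Zr ζ r t) θ := by positivity
      have h6 := mul_le_mul h4 h3 hpp.le (by positivity)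
      rw [hM, mul_assoc (2*C)]
      linarith
  have h7 := norm_integral_le_of_norm_le
    ((hI2 _).add (integrable_const _)) (Eventually.of_forall key)
  rw [Real.norm_eq_abs] at h7
  refine h7.trans_lt ?_
  rw [integral_add' (hI2 _) (integrable_const _),
    integral_const_mul, mean_pk h hr0.le hr1 θ]
  simp only [integral_const, probReal_univ, smul_eq_mul, one_mul]
  rw [div_mul_cancel₀ _ hp.ne']
  linarith

/-- weak convergence -/
lemma weak_conv {ζ : ℂ} (h : ‖ζ‖ < 1) {χ : ℂ → ℝ}
    (hχ : ContinuousOn χ (Metric.closedBall 0 1)) (ν : Measure ℝ) [IsProbabilityMeasure ν] :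
    Tendsto (fun r => ∫ t, χ (Zr ζ r t) * (Cara ν (Zr ζ r t)).re ∂lam) (𝓝[<] 1)
      (𝓝 (∫ θ, χ (ctheta θ) * pk ζ θ ∂ν)) := by
  obtain ⟨C, hC⟩ := (isCompact_closedBall (0:ℂ) 1).exists_bound_of_continuousOn hχ
  have h2 : ∀ᶠ r : ℝ in 𝓝[<] 1, r ∈ Ioo (0:ℝ) 1 := Ioo_mem_nhdsLT zero_lt_one
  have hlim : Tendsto (fun r => ∫ θ, ∫ t, χ (Zr ζ r t) * pk (Zr ζ r t) θ ∂lam ∂ν) (𝓝[<] 1)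
      (𝓝 (∫ θ, χ (ctheta θ) * pk ζ θ ∂ν)) := by
    refine tendsto_integral_filter_of_dominated_convergence (fun θ => C * (2/(1-‖ζ‖))) ?_ ?_
      (integrable_const _) (Eventually.of_forall fun θ => conc h hχ θ)
    · filter_upwards [h2] with r ⟨hr0, hr1⟩
      have := fub_int h hr0.le hr1 ν (integrable_const (1:ℝ)) hχ
      simp only [one_mul] at this
      exact this.integral_prod_left.aestronglyMeasurable
    · filter_upwards [h2] with r ⟨hr0, hr1⟩
      refine Eventually.of_forall fun θ => ?_
      have hpZ : Continuous fun t => pk (Zr ζ r t) θ := cont_Zr h hr0.le hr1 (contOn_pk θ)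
      have hC0 : 0 ≤ C := (norm_nonneg _).trans (hC (ctheta θ) (by simp [norm_ctheta]))
      have h7 := norm_integral_le_of_norm_le (f := fun t => χ (Zr ζ r t) * pk (Zr ζ r t) θ)
        ((int_lam hpZ).const_mul C) (Eventually.of_forall fun t => by
          have hz := Zr_lt h hr0.le hr1 t
          have hpp := pk_pos hz θ
          rw [norm_mul, Real.norm_of_nonneg hpp.le]
          exact mul_le_mul_of_nonneg_right (hC _ (by simpa using hz.le)) hpp.le)
      refine h7.trans ?_
      rw [integral_const_mul, mean_pk h hr0.le hr1]
      exact mul_le_mul_of_nonneg_left (pk_le h θ) hC0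
  refine hlim.congr' ?_
  filter_upwards [h2] with r ⟨hr0, hr1⟩
  have := fub h hr0.le hr1 ν (integrable_const (1:ℝ)) hχ
  simp only [one_mul] at this
  rw [← this]
  refine integral_congr_ae (Eventually.of_forall fun t => ?_)
  simp only
  rw [cara_re ν (Zr_lt h hr0.le hr1 t)]

lemma weak_conv' {ζ : ℂ} (h : ‖ζ‖ < 1) {χ : ℂ → ℝ}
    (hχ : ContinuousOn χ (Metric.closedBall 0 1)) :
    Tendsto (fun r => ∫ t, χ (Zr ζ r t) ∂lam) (𝓝[<] 1)
      (𝓝 (∫ θ, χ (ctheta θ) ∂(PoisM ζ))) := by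
  rw [integral_PoisM h]
  refine (weak_conv h hχ lam).congr' ?_
  have h2 : ∀ᶠ r : ℝ in 𝓝[<] 1, r ∈ Ioo (0:ℝ) 1 := Ioo_mem_nhdsLT zero_lt_one
  filter_upwards [h2] with r ⟨hr0, hr1⟩
  refine integral_congr_ae (Eventually.of_forall fun t => ?_)
  simp only
  rw [cara_re lam (Zr_lt h hr0.le hr1 t), integral_pk (Zr_lt h hr0.le hr1 t), mul_one]

lemma log_pk {ζ : ℂ} (h : ‖ζ‖ < 1) (θ : ℝ) :
    Real.log (pk ζ θ) = Real.log (1 - ‖ζ‖^2) - 2 * Real.log ‖1 - conj ζ * ctheta θ‖ := by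
  have h1 : ‖ctheta θ - ζ‖^2 = ‖1 - conj ζ * ctheta θ‖^2 := by
    have := norm_mob ζ (ctheta θ)
    rw [norm_ctheta] at this
    linarith
  have h3 : 0 < 1 - ‖ζ‖^2 := by nlinarith [norm_nonneg ζ]
  have h4 := norm_ne_zero_iff.2 (one_sub_ne h (norm_ctheta θ).le)
  rw [pk, h1, Real.log_div h3.ne' (pow_ne_zero 2 h4), Real.log_pow]
  norm_num

lemma one_sub_re_pos {a b : ℂ} (h : ‖a‖ < 1) (hb : ‖b‖ ≤ 1) : 0 < (1 - conj a * b).re := by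
  have h1 : (conj a * b).re ≤ ‖conj a * b‖ := Complex.re_le_norm _
  rw [norm_mul, RCLike.norm_conj] at h1
  simp only [Complex.sub_re, Complex.one_re]
  nlinarith [norm_nonneg a, norm_nonneg b]

lemma integral_log_pk {ζ : ℂ} (h : ‖ζ‖ < 1) :
    ∫ θ, Real.log (pk ζ θ) ∂(PoisM ζ) = - Real.log (1 - ‖ζ‖^2) := by
  have hP := isProb_PoisM h
  have hc : ContinuousOn (fun z => Real.log (1 - ‖ζ‖^2) - 2 * Real.log ‖1 - conj ζ * z‖)
      (Metric.closedBall 0 1) := by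
    refine continuousOn_const.sub (continuousOn_const.mul (ContinuousOn.log (by fun_prop) fun z hz => ?_))
    exact norm_ne_zero_iff.2 (one_sub_ne h (by simpa using hz))
  have h1 := weak_conv' h hc
  simp only [log_pk h]
  refine tendsto_nhds_unique h1 ((tendsto_const_nhds (x := - Real.log (1 - ‖ζ‖^2))).congr' ?_)
  have h2 : ∀ᶠ r : ℝ in 𝓝[<] 1, r ∈ Ioo (0:ℝ) 1 := Ioo_mem_nhdsLT zero_lt_one
  filter_upwards [h2] with r ⟨hr0, hr1⟩
  have hd : DifferentiableOn ℂ (fun z => 1 - conj ζ * z) (Metric.ball 0 1) := by fun_prop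
  have hl : Integrable (fun t => Real.log ‖1 - conj ζ * Zr ζ r t‖) lam := by
    refine int_Zr (g := fun z => Real.log ‖1 - conj ζ * z‖) h hr0.le hr1 ?_
    refine ContinuousOn.log (by fun_prop) fun z hz => ?_
    have : ‖z‖ < 1 := by simpa using hz
    exact norm_ne_zero_iff.2 (one_sub_ne h this.le)
  rw [integral_sub (integrable_const _) (hl.const_mul _), integral_const_mul,
    mean_Zr_log h hr0.le hr1 hd fun z hz => ?_]
  · have h3 : 0 < 1 - ‖ζ‖^2 := by nlinarith [norm_nonneg ζ]
    have : ‖1 - conj ζ * ζ‖ = 1 - ‖ζ‖^2 := by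
      rw [mul_comm, Complex.mul_conj, Complex.normSq_eq_norm_sq]
      rw [← Complex.ofReal_one, ← Complex.ofReal_sub, Complex.norm_real, Real.norm_of_nonneg h3.le]
    rw [this]
    simp
    ring
  · have : ‖z‖ < 1 := by simpa using hz
    exact one_sub_re_pos h this.le

/-- Schur class functions on the disk. -/
def Sch (g : ℂ → ℂ) : Prop :=
  DifferentiableOn ℂ g (Metric.ball 0 1) ∧ ∀ z : ℂ, ‖z‖ < 1 → ‖g z‖ ≤ 1

lemma mem_b {z : ℂ} (hz : ‖z‖ < 1) : z ∈ Metric.ball (0:ℂ) 1 := by simpa using hz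
lemma of_b {z : ℂ} (hz : z ∈ Metric.ball (0:ℂ) 1) : ‖z‖ < 1 := by simpa using hz

def Nf (ζ : ℂ) (g : ℂ → ℂ) (z : ℂ) : ℂ := (g z - g ζ)/(1 - conj (g ζ) * g z)

def om (ζ : ℂ) : ℂ := -ζ/(‖ζ‖:ℂ)

lemma om_norm {ζ : ℂ} (h0 : ζ ≠ 0) : ‖om ζ‖ = 1 := by
  have := norm_pos_iff.2 h0
  rw [om, norm_div, norm_neg, Complex.norm_real, norm_norm, div_self this.ne']

lemma om_ne {ζ : ℂ} (h0 : ζ ≠ 0) : om ζ ≠ 0 := by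
  rw [← norm_ne_zero_iff, om_norm h0]; exact one_ne_zero

lemma diff_Nf {ζ : ℂ} {g : ℂ → ℂ} (hg : Sch g) (h1 : ‖g ζ‖ < 1) :
    DifferentiableOn ℂ (Nf ζ g) (Metric.ball 0 1) := by
  unfold Nf
  have := hg.1
  refine DifferentiableOn.div (by fun_prop) (by fun_prop) fun z hz => one_sub_ne h1 (hg.2 z (of_b hz))

lemma Nf_self (ζ : ℂ) (g : ℂ → ℂ) : Nf ζ g ζ = 0 := by simp [Nf]

lemma npStep_eq {ζ : ℂ} (h : ‖ζ‖ < 1) {g : ℂ → ℂ} (hg : Sch g) (h1 : ‖g ζ‖ < 1)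
    {z : ℂ} (hz : ‖z‖ < 1) :
    npStep ζ g z = om ζ * (1 - conj ζ * z) * dslope (Nf ζ g) ζ z := by
  have key : ∀ z : ℂ, z ≠ ζ → ‖z‖ < 1 →
      npRaw ζ g z = om ζ * (1 - conj ζ * z) * dslope (Nf ζ g) ζ z := by
    intro z hne hz
    rw [dslope_of_ne _ hne, slope_def_field, Nf_self, sub_zero]
    have h2 : 1 - conj ζ * z ≠ 0 := one_sub_ne h hz.le
    have h3 : z - ζ ≠ 0 := sub_ne_zero.2 hne
    have h4 : npRaw ζ g z = om ζ / mtrans ζ z * Nf ζ g z := rfl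
    rw [h4, mtrans]
    generalize Nf ζ g z = n at *
    generalize om ζ = o at *
    rw [div_div_eq_mul_div]
    ring
  have hd : DifferentiableOn ℂ (dslope (Nf ζ g) ζ) (Metric.ball 0 1) :=
    (Complex.differentiableOn_dslope (Metric.isOpen_ball.mem_nhds (mem_b h))).2 (diff_Nf hg h1)
  by_cases hne : z = ζ
  · subst hne
    simp only [npStep, if_true]
    have hc : ContinuousAt (fun w => om z * (1 - conj z * w) * dslope (Nf z g) z w) z := by
      have : ContinuousAt (dslope (Nf z g) z) z :=
        (hd.differentiableAt (Metric.isOpen_ball.mem_nhds (mem_b h))).continuousAt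
      fun_prop
    have ht : Tendsto (npRaw z g) (𝓝[≠] z) (𝓝 (om z * (1 - conj z * z) * dslope (Nf z g) z z)) := by
      refine (hc.tendsto.mono_left nhdsWithin_le_nhds).congr' ?_
      filter_upwards [self_mem_nhdsWithin,
        nhdsWithin_le_nhds (Metric.isOpen_ball.mem_nhds (mem_b h))] with w hw1 hw2
      exact (key w hw1 (of_b hw2)).symm
    exact ht.limUnder_eq
  · simp only [npStep, if_neg hne]
    exact key z hne hz

lemma npStep_diff {ζ : ℂ} (h : ‖ζ‖ < 1) {g : ℂ → ℂ} (hg : Sch g) (h1 : ‖g ζ‖ < 1) :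
    DifferentiableOn ℂ (npStep ζ g) (Metric.ball 0 1) := by
  have hd : DifferentiableOn ℂ (dslope (Nf ζ g) ζ) (Metric.ball 0 1) :=
    (Complex.differentiableOn_dslope (Metric.isOpen_ball.mem_nhds (mem_b h))).2 (diff_Nf hg h1)
  refine DifferentiableOn.congr (f := fun z => om ζ * (1 - conj ζ * z) * dslope (Nf ζ g) ζ z) ?_
    fun z hz => npStep_eq h hg h1 (of_b hz)
  fun_prop

lemma mtrans_npStep {ζ : ℂ} (h : ‖ζ‖ < 1) {g : ℂ → ℂ} (hg : Sch g) (h1 : ‖g ζ‖ < 1)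
    {z : ℂ} (hz : ‖z‖ < 1) : mtrans ζ z * npStep ζ g z = om ζ * Nf ζ g z := by
  rw [npStep_eq h hg h1 hz, mtrans]
  have h2 : 1 - conj ζ * z ≠ 0 := one_sub_ne h hz.le
  have h3 : Nf ζ g z = (z - ζ) * dslope (Nf ζ g) ζ z := by
    have := sub_smul_dslope (Nf ζ g) ζ z
    rw [Nf_self, sub_zero, smul_eq_mul] at this
    exact this.symm
  rw [h3]
  generalize dslope (Nf ζ g) ζ z = d
  rw [div_mul_eq_mul_div, div_eq_iff h2]
  ring

lemma norm_Nf_le {ζ z : ℂ} {g : ℂ → ℂ} (hg : Sch g) (h1 : ‖g ζ‖ < 1)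
    (hz : ‖z‖ < 1) : ‖Nf ζ g z‖ ≤ 1 := by
  have h2 := norm_mob (g ζ) (g z)
  have h3 := hg.2 z hz
  have h4 := norm_pos_iff.2 (one_sub_ne h1 h3)
  rw [Nf, norm_div, div_le_one h4]
  refine abs_le_of_sq_le_sq' ?_ h4.le |>.2
  have : 0 ≤ (1 - ‖g ζ‖^2) * (1 - ‖g z‖^2) :=
    mul_nonneg (by nlinarith [norm_nonneg (g ζ)]) (by nlinarith [norm_nonneg (g z)])
  linarith

lemma npStep_le {ζ : ℂ} (h : ‖ζ‖ < 1) (h0 : ζ ≠ 0) {g : ℂ → ℂ} (hg : Sch g) (h1 : ‖g ζ‖ < 1)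
    {z : ℂ} (hz : ‖z‖ < 1) : ‖npStep ζ g z‖ ≤ 1 := by
  set w := mtrans ζ z with hw
  have hw1 : ‖w‖ < 1 := norm_mtrans_lt h hz
  have hzw : Tm ζ w = z := Tm_mtrans h hz
  have hd : DifferentiableOn ℂ (fun w => npStep ζ g (Tm ζ w)) (Metric.ball 0 1) :=
    (npStep_diff h hg h1).comp (diff_Tm h) fun w hw => mem_b (norm_Tm_lt h (of_b hw))
  have key : ∀ r : ℝ, ‖w‖ < r → r < 1 → ‖npStep ζ g z‖ ≤ 1 / r := by
    intro r hr hr1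
    have hr0 : 0 < r := lt_of_le_of_lt (norm_nonneg w) hr
    have hcl : closure (Metric.ball (0:ℂ) r) ⊆ Metric.ball 0 1 :=
      Metric.closure_ball_subset_closedBall.trans (Metric.closedBall_subset_ball hr1)
    have := Complex.norm_le_of_forall_mem_frontier_norm_le (f := fun w => npStep ζ g (Tm ζ w))
      (U := Metric.ball 0 r) (C := 1/r) Metric.isBounded_ball (hd.mono hcl).diffContOnCl ?_
      (z := w) (subset_closure (by simpa using hr))
    · simpa only [hzw] using this
    · intro u hu
      rw [frontier_ball _ hr0.ne'] at hu
      have hu1 : ‖u‖ = r := by simpa using hu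
      have hu2 : ‖Tm ζ u‖ < 1 := norm_Tm_lt h (by linarith)
      have h2 := congrArg norm (mtrans_npStep h hg h1 hu2)
      rw [mtrans_Tm h (by linarith), norm_mul, norm_mul, om_norm h0, one_mul, hu1] at h2
      rw [le_div_iff₀ hr0, mul_comm, h2]
      exact norm_Nf_le hg h1 hu2
  have ht : Tendsto (fun r : ℝ => 1 / r) (𝓝[<] 1) (𝓝 (1/1)) := by
    refine (ContinuousAt.tendsto ?_).mono_left nhdsWithin_le_nhds
    exact continuousAt_const.div continuousAt_id one_ne_zero
  rw [div_one] at ht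
  refine ge_of_tendsto ht ?_
  filter_upwards [Ioo_mem_nhdsLT hw1] with r hr
  exact key r hr.1 hr.2

lemma npStep_Sch {ζ : ℂ} (h : ‖ζ‖ < 1) (h0 : ζ ≠ 0) {g : ℂ → ℂ} (hg : Sch g) (h1 : ‖g ζ‖ < 1) :
    Sch (npStep ζ g) :=
  ⟨npStep_diff h hg h1, fun _ hz => npStep_le h h0 hg h1 hz⟩

lemma Sch_const {ζ : ℂ} (h : ‖ζ‖ < 1) {g : ℂ → ℂ} (hg : Sch g) (h1 : ‖g ζ‖ = 1)
    {z : ℂ} (hz : ‖z‖ < 1) : g z = g ζ := by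
  have := Complex.eqOn_of_isPreconnected_of_isMaxOn_norm (f := g) (U := Metric.ball (0:ℂ) 1) (c := ζ)
    (convex_ball _ _).isPreconnected Metric.isOpen_ball hg.1 (mem_b h)
    (fun w hw => by simpa [h1] using hg.2 w (of_b hw))
  exact this (mem_b hz)

lemma Sch_strict {ζ : ℂ} (h : ‖ζ‖ < 1) {g : ℂ → ℂ} (hg : Sch g) (h1 : ‖g ζ‖ < 1)
    {z : ℂ} (hz : ‖z‖ < 1) : ‖g z‖ < 1 := by
  refine lt_of_le_of_ne (hg.2 z hz) fun h2 => ?_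
  have := Sch_const hz hg h2 h
  rw [this, h2] at h1
  exact lt_irrefl _ h1

def ph (s : ℂ) : ℝ := -Real.log (1 - ‖s‖^2)

lemma one_sub_sq_pos {s : ℂ} (h : ‖s‖ < 1) : 0 < 1 - ‖s‖^2 := by nlinarith [norm_nonneg s]

lemma ph_mono {a b : ℂ} (h : ‖a‖ ≤ ‖b‖) (hb : ‖b‖ < 1) : ph a ≤ ph b := by
  unfold ph
  have := one_sub_sq_pos hb
  have h2 : 1 - ‖b‖^2 ≤ 1 - ‖a‖^2 := by nlinarith [norm_nonneg a]
  linarith [Real.log_le_log this h2]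

lemma ph_zero : ph 0 = 0 := by simp [ph]

lemma ph_nonneg {a : ℂ} (h : ‖a‖ < 1) : 0 ≤ ph a := by
  rw [← ph_zero]; exact ph_mono (by simp) h

lemma ph_congr {a b : ℂ} (h : ‖a‖ = ‖b‖) : ph a = ph b := by rw [ph, ph, h]

lemma ph_smul_le {r : ℝ} (hr : 0 ≤ r) (hr1 : r < 1) {s : ℂ} (h : ‖s‖ < 1) :
    ph (r * s) ≤ r^2 * ph s := by
  have h1 := one_sub_sq_pos h
  have h2 : ‖(r:ℂ) * s‖^2 = r^2 * ‖s‖^2 := by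
    rw [norm_mul, Complex.norm_real, Real.norm_of_nonneg hr, mul_pow]
  have h3 := _root_.rpow_one_add_le_one_add_mul_self (s := -‖s‖^2) (p := r^2) (by linarith)
    (by positivity) (by nlinarith)
  have h4 : 0 < (1 + -‖s‖^2) := by linarith
  have h5 := Real.log_le_log (Real.rpow_pos_of_pos h4 _) h3
  rw [Real.log_rpow h4] at h5
  unfold ph
  rw [h2, show 1 - r^2 * ‖s‖^2 = 1 + r^2 * -‖s‖^2 by ring, show 1 - ‖s‖^2 = 1 + -‖s‖^2 by ring]
  linarith

lemma contOn_ph {g : ℂ → ℂ} (hg : ContinuousOn g (Metric.ball 0 1))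
    (hs : ∀ z : ℂ, ‖z‖ < 1 → ‖g z‖ < 1) : ContinuousOn (fun z => ph (g z)) (Metric.ball 0 1) := by
  unfold ph
  refine (ContinuousOn.log (by fun_prop) fun z hz => ?_).neg
  exact (one_sub_sq_pos (hs z (of_b hz))).ne'

lemma ph_step {ζ : ℂ} (h : ‖ζ‖ < 1) (h0 : ζ ≠ 0) {g : ℂ → ℂ} (hg : Sch g) (h1 : ‖g ζ‖ < 1)
    {z : ℂ} (hz : ‖z‖ < 1) :
    ph (g z) = ph (mtrans ζ z * npStep ζ g z)
      + (Real.log (1 - ‖g ζ‖^2) - 2 * Real.log ‖1 - conj (g ζ) * g z‖) := by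
  have h2 : ‖mtrans ζ z * npStep ζ g z‖ = ‖Nf ζ g z‖ := by
    rw [mtrans_npStep h hg h1 hz, norm_mul, om_norm h0, one_mul]
  rw [ph_congr h2]
  have h3 := norm_mob (g ζ) (g z)
  have hgz := Sch_strict h hg h1 hz
  have h4 := norm_pos_iff.2 (one_sub_ne h1 hgz.le)
  have h5 : 1 - ‖Nf ζ g z‖^2 = (1 - ‖g ζ‖^2) * (1 - ‖g z‖^2) / ‖1 - conj (g ζ) * g z‖^2 := by
    rw [← h3, Nf, norm_div, div_pow, one_sub_div (by positivity)]
  have h6 := one_sub_sq_pos h1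
  have h7 := one_sub_sq_pos hgz
  unfold ph
  rw [h5, Real.log_div (by positivity) (by positivity), Real.log_mul h6.ne' h7.ne', Real.log_pow]
  push_cast
  ring

lemma int_step {ζ : ℂ} (h : ‖ζ‖ < 1) (h0 : ζ ≠ 0) {g : ℂ → ℂ} (hg : Sch g) (h1 : ‖g ζ‖ < 1)
    {r : ℝ} (hr : 0 ≤ r) (hr1 : r < 1) :
    ∫ t, ph (g (Zr ζ r t)) ∂lam = ph (g ζ) + ∫ t, ph (r * npStep ζ g (Zr ζ r t)) ∂lam := by
  have e1 : ∀ t, ph (g (Zr ζ r t)) = ph (r * npStep ζ g (Zr ζ r t))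
      + (Real.log (1 - ‖g ζ‖^2) - 2 * Real.log ‖1 - conj (g ζ) * g (Zr ζ r t)‖) := by
    intro t
    rw [ph_step h h0 hg h1 (Zr_lt h hr hr1 t)]
    congr 1
    apply ph_congr
    rw [norm_mul, norm_mul, mtrans_Zr h hr hr1, Complex.norm_real, Real.norm_of_nonneg hr]
  have hgc := hg.1
  have hs := npStep_Sch h h0 hg h1
  have i1 : Integrable (fun t => ph (r * npStep ζ g (Zr ζ r t))) lam := by
    refine int_Zr h hr hr1 (g := fun z => ph (r * npStep ζ g z)) (contOn_ph ?_ ?_)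
    · have := hs.1.continuousOn
      fun_prop
    · intro z hz
      rw [norm_mul, Complex.norm_real, Real.norm_of_nonneg hr]
      nlinarith [hs.2 z hz, norm_nonneg (npStep ζ g z)]
  have hd : DifferentiableOn ℂ (fun z => 1 - conj (g ζ) * g z) (Metric.ball 0 1) := by fun_prop
  have i2 : Integrable (fun t => Real.log ‖1 - conj (g ζ) * g (Zr ζ r t)‖) lam := by
    refine int_Zr h hr hr1 (g := fun z => Real.log ‖1 - conj (g ζ) * g z‖) ?_
    refine ContinuousOn.log hd.continuousOn.norm fun z hz => ?_
    exact norm_ne_zero_iff.2 (one_sub_ne h1 (hg.2 z (of_b hz)))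
  have m := mean_Zr_log h hr hr1 hd (fun z hz => one_sub_re_pos h1 (hg.2 z (of_b hz)))
  simp only [e1]
  rw [integral_add i1 (by exact (integrable_const _).sub (i2.const_mul 2)),
    integral_sub (integrable_const _) (i2.const_mul 2), integral_const_mul, m]
  have h8 : ‖1 - conj (g ζ) * g ζ‖ = 1 - ‖g ζ‖^2 := by
    rw [mul_comm, Complex.mul_conj, Complex.normSq_eq_norm_sq, ← Complex.ofReal_one,
      ← Complex.ofReal_sub, Complex.norm_real, Real.norm_of_nonneg (one_sub_sq_pos h1).le]
  rw [h8]
  simp only [integral_const, probReal_univ, one_smul, ph]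
  ring

lemma iter_Sch {ζ : ℂ} (h : ‖ζ‖ < 1) (h0 : ζ ≠ 0) {f : ℂ → ℂ} (hf : Sch f) (n : ℕ)
    (hs : ∀ k < n, ‖((npStep ζ)^[k] f) ζ‖ < 1) : Sch ((npStep ζ)^[n] f) := by
  induction n with
  | zero => simpa using hf
  | succ n ih =>
    rw [Function.iterate_succ_apply']
    exact npStep_Sch h h0 (ih fun k hk => hs k (by omega)) (hs n (by omega))

lemma int_ph {ζ : ℂ} (h : ‖ζ‖ < 1) {g : ℂ → ℂ} (hg : Sch g) (h1 : ‖g ζ‖ < 1)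
    {r : ℝ} (hr : 0 ≤ r) (hr1 : r < 1) : Integrable (fun t => ph (g (Zr ζ r t))) lam :=
  int_Zr h hr hr1 (g := fun z => ph (g z))
    (contOn_ph hg.1.continuousOn fun _ hz => Sch_strict h hg h1 hz)

lemma norm_rm {r : ℝ} (hr : 0 ≤ r) (s : ℂ) : ‖(r:ℂ) * s‖ = r * ‖s‖ := by
  rw [norm_mul, Complex.norm_real, Real.norm_of_nonneg hr]

lemma norm_rm_lt {r : ℝ} (hr : 0 ≤ r) (hr1 : r < 1) {s : ℂ} (hs : ‖s‖ ≤ 1) : ‖(r:ℂ) * s‖ < 1 := by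
  rw [norm_rm hr]; nlinarith [norm_nonneg s]

lemma int_ph_r {ζ : ℂ} (h : ‖ζ‖ < 1) {g : ℂ → ℂ} (hg : Sch g)
    {q r : ℝ} (hq : 0 ≤ q) (hq1 : q < 1) (hr : 0 ≤ r) (hr1 : r < 1) :
    Integrable (fun t => ph (q * g (Zr ζ r t))) lam := by
  refine int_Zr h hr hr1 (g := fun z => ph (q * g z)) (contOn_ph ?_ ?_)
  · have := hg.1.continuousOn
    fun_prop
  · intro z hz
    exact norm_rm_lt hq hq1 (hg.2 z hz)

lemma upper_aux {ζ : ℂ} (h : ‖ζ‖ < 1) (h0 : ζ ≠ 0) {f : ℂ → ℂ} (hf : Sch f)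
    (hs : ∀ k, ‖((npStep ζ)^[k] f) ζ‖ < 1) {r : ℝ} (hr : 0 ≤ r) (hr1 : r < 1) (n : ℕ) :
    ∫ t, ph (f (Zr ζ r t)) ∂lam ≤ ∑ k ∈ Finset.range (n+1), ph (((npStep ζ)^[k] f) ζ)
      + (r^2)^n * ∫ t, ph (r * ((npStep ζ)^[n+1] f) (Zr ζ r t)) ∂lam := by
  induction n with
  | zero =>
    have := int_step h h0 hf (hs 0) hr hr1
    simp [this]
  | succ n ih =>
    have hS := iter_Sch h h0 hf (n+1) fun k _ => hs k
    have e := int_step h h0 hS (hs (n+1)) hr hr1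
    rw [← Function.iterate_succ_apply' (npStep ζ)] at e
    have le : ∫ t, ph (r * ((npStep ζ)^[n+1] f) (Zr ζ r t)) ∂lam ≤
        r^2 * ∫ t, ph (((npStep ζ)^[n+1] f) (Zr ζ r t)) ∂lam := by
      rw [← integral_const_mul]
      refine integral_mono (int_ph_r h hS hr hr1 hr hr1) ((int_ph h hS (hs _) hr hr1).const_mul _) ?_
      intro t
      exact ph_smul_le hr hr1 (Sch_strict h hS (hs _) (Zr_lt h hr hr1 t))
    rw [e] at le
    have p1 := ph_nonneg (hs (n+1))
    have p2 : r^2 ≤ 1 := by nlinarith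
    have p3 : (r^2)^n ≤ 1 := pow_le_one₀ (by positivity) p2
    have p4 : 0 ≤ (r^2)^n := by positivity
    rw [Finset.sum_range_succ]
    have q1 := mul_le_mul_of_nonneg_left le p4
    have q2 : (r^2)^n * (r^2 * ph (((npStep ζ)^[n+1] f) ζ)) ≤ ph (((npStep ζ)^[n+1] f) ζ) := by
      rw [← mul_assoc]
      exact mul_le_of_le_one_left p1 (mul_le_one₀ p3 (by positivity) p2)
    rw [pow_succ]
    linarith

lemma upper {ζ : ℂ} (h : ‖ζ‖ < 1) (h0 : ζ ≠ 0) {f : ℂ → ℂ} (hf : Sch f)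
    (hs : ∀ k, ‖((npStep ζ)^[k] f) ζ‖ < 1) {S : ℝ}
    (hS : ∀ n, ∑ k ∈ Finset.range n, ph (((npStep ζ)^[k] f) ζ) ≤ S)
    {r : ℝ} (hr : 0 ≤ r) (hr1 : r < 1) :
    ∫ t, ph (f (Zr ζ r t)) ∂lam ≤ S := by
  have key : ∀ n : ℕ, ∫ t, ph (f (Zr ζ r t)) ∂lam ≤ S + (r^2)^n * ph (r:ℂ) := by
    intro n
    refine (upper_aux h h0 hf hs hr hr1 n).trans (add_le_add (hS _) ?_)
    refine mul_le_mul_of_nonneg_left ?_ (by positivity)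
    have hSc := iter_Sch h h0 hf (n+1) fun k _ => hs k
    have := integral_mono (int_ph_r h hSc hr hr1 hr hr1) (integrable_const (ph (r:ℂ))) (fun t => by
      refine ph_mono ?_ ?_
      · rw [norm_mul]
        exact mul_le_of_le_one_right (norm_nonneg _) (hSc.2 _ (Zr_lt h hr hr1 t))
      · rw [Complex.norm_real, Real.norm_of_nonneg hr]; exact hr1)
    simpa using this
  have ht : Tendsto (fun n : ℕ => S + (r^2)^n * ph (r:ℂ)) atTop (𝓝 (S + 0 * ph (r:ℂ))) := by
    refine ((tendsto_pow_atTop_nhds_zero_of_lt_one (by positivity) ?_).mul_const _).const_add _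
    nlinarith
  rw [zero_mul, add_zero] at ht
  exact ge_of_tendsto' ht key

/-- damped Nevanlinna-Pick iterates -/
def Gq (ζ : ℂ) (f : ℂ → ℂ) (q : ℝ) : ℕ → ℂ → ℂ
  | 0 => fun z => q * f z
  | n+1 => fun z => q * npStep ζ (Gq ζ f q n) z

lemma Sch_smul {g : ℂ → ℂ} (hg : Sch g) {q : ℝ} (hq : 0 ≤ q) (hq1 : q < 1) :
    Sch (fun z => q * g z) :=
  ⟨by have := hg.1; fun_prop, fun z hz => (norm_rm_lt hq hq1 (hg.2 z hz)).le⟩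

lemma Gq_Sch {ζ : ℂ} (h : ‖ζ‖ < 1) (h0 : ζ ≠ 0) {f : ℂ → ℂ} (hf : Sch f)
    {q : ℝ} (hq : 0 ≤ q) (hq1 : q < 1) (n : ℕ) :
    Sch (Gq ζ f q n) ∧ ‖Gq ζ f q n ζ‖ < 1 := by
  induction n with
  | zero => exact ⟨Sch_smul hf hq hq1, norm_rm_lt hq hq1 (hf.2 ζ h)⟩
  | succ n ih =>
    have := npStep_Sch h h0 ih.1 ih.2
    exact ⟨Sch_smul this hq hq1, norm_rm_lt hq hq1 (this.2 ζ h)⟩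

lemma lower_aux {ζ : ℂ} (h : ‖ζ‖ < 1) (h0 : ζ ≠ 0) {f : ℂ → ℂ} (hf : Sch f)
    {q r : ℝ} (hq : 0 ≤ q) (hqr : q ≤ r) (hr1 : r < 1) (n : ℕ) :
    ∑ k ∈ Finset.range n, ph (Gq ζ f q k ζ) + ∫ t, ph (Gq ζ f q n (Zr ζ r t)) ∂lam ≤
      ∫ t, ph (q * f (Zr ζ r t)) ∂lam := by
  have hr : 0 ≤ r := hq.trans hqr
  have hq1 : q < 1 := hqr.trans_lt hr1
  induction n with
  | zero => simp [Gq]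
  | succ n ih =>
    refine le_trans ?_ ih
    obtain ⟨a, b⟩ := Gq_Sch h h0 hf hq hq1 n
    have hS := npStep_Sch h h0 a b
    rw [int_step h h0 a b hr hr1, Finset.sum_range_succ, add_assoc]
    refine add_le_add le_rfl (add_le_add le_rfl ?_)
    refine integral_mono (int_ph_r h hS hq hq1 hr hr1) (int_ph_r h hS hr hr1 hr hr1) fun t => ?_
    have hS2 := hS.2 _ (Zr_lt h hr hr1 t)
    refine ph_mono ?_ (norm_rm_lt hr hr1 hS2)
    rw [Gq, norm_rm hq, norm_rm hr]
    gcongr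

lemma Zr_ne {ζ : ℂ} (h : ‖ζ‖ < 1) {r : ℝ} (hr : 0 < r) (hr1 : r < 1) (t : ℝ) : Zr ζ r t ≠ ζ := by
  intro h1
  have := mtrans_Zr h hr.le hr1 t
  rw [h1] at this
  simp [mtrans] at this
  exact hr.ne this

lemma Gq_tendsto {ζ : ℂ} (h : ‖ζ‖ < 1) (h0 : ζ ≠ 0) {f : ℂ → ℂ} (hf : Sch f)
    (hs : ∀ k, ‖((npStep ζ)^[k] f) ζ‖ < 1) (n : ℕ) :
    ∀ z : ℂ, ‖z‖ < 1 → Tendsto (fun q => Gq ζ f q n z) (𝓝[<] 1) (𝓝 ((npStep ζ)^[n] f z)) := by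
  have hq : Tendsto (fun q : ℝ => (q:ℂ)) (𝓝[<] 1) (𝓝 1) := by
    have : Tendsto (fun q : ℝ => (q:ℂ)) (𝓝 1) (𝓝 ((1:ℝ):ℂ)) := Complex.continuous_ofReal.tendsto 1
    rw [Complex.ofReal_one] at this
    exact this.mono_left nhdsWithin_le_nhds
  have hev : ∀ᶠ q : ℝ in 𝓝[<] 1, 0 < q ∧ q < 1 := Ioo_mem_nhdsLT one_pos
  induction n with
  | zero =>
    intro z hz
    simpa [Gq] using hq.mul_const (f z)
  | succ n ih =>
    rw [Function.iterate_succ_apply']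
    have hS := iter_Sch h h0 hf n fun k _ => hs k
    have hn := hs n
    set g := (npStep ζ)^[n] f with hg
    have key : ∀ z : ℂ, ‖z‖ < 1 → z ≠ ζ →
        Tendsto (fun q => npStep ζ (Gq ζ f q n) z) (𝓝[<] 1) (𝓝 (npStep ζ g z)) := by
      intro z hz hne
      simp only [npStep, if_neg hne, npRaw]
      refine Tendsto.const_mul _ (Tendsto.div ((ih z hz).sub (ih ζ h)) ?_ ?_)
      · refine tendsto_const_nhds.sub (Tendsto.mul ?_ (ih z hz))
        exact (Complex.continuous_conj.tendsto _).comp (ih ζ h)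
      · exact one_sub_ne hn (hS.2 z hz)
    suffices H : ∀ z : ℂ, ‖z‖ < 1 →
        Tendsto (fun q => npStep ζ (Gq ζ f q n) z) (𝓝[<] 1) (𝓝 (npStep ζ g z)) by
      intro z hz
      have := hq.mul (H z hz)
      rw [one_mul] at this
      exact this
    intro z hz
    by_cases hne : z = ζ
    · subst hne
      have hr : (0:ℝ) ≤ 1/2 := by norm_num
      have hr1 : (1/2:ℝ) < 1 := by norm_num
      have hT : Tendsto (fun q => ∫ t, npStep z (Gq z f q n) (Zr z (1/2) t) ∂lam) (𝓝[<] 1)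
          (𝓝 (∫ t, npStep z g (Zr z (1/2) t) ∂lam)) := by
        refine tendsto_integral_filter_of_dominated_convergence (fun _ => (1:ℝ)) ?_ ?_
          (integrable_const _) ?_
        · filter_upwards [hev] with q hq
          obtain ⟨a, b⟩ := Gq_Sch h h0 hf hq.1.le hq.2 n
          exact (int_Zr h hr hr1 (npStep_Sch h h0 a b).1.continuousOn).aestronglyMeasurable
        · filter_upwards [hev] with q hq
          obtain ⟨a, b⟩ := Gq_Sch h h0 hf hq.1.le hq.2 n
          exact Eventually.of_forall fun t => npStep_le h h0 a b (Zr_lt h hr hr1 t)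
        · exact Eventually.of_forall fun t => key _ (Zr_lt h hr hr1 t) (Zr_ne h (by norm_num) hr1 t)
      rw [mean_Zr h hr hr1 (npStep_Sch h h0 hS hn).1] at hT
      refine hT.congr' ?_
      filter_upwards [hev] with q hq
      obtain ⟨a, b⟩ := Gq_Sch h h0 hf hq.1.le hq.2 n
      exact mean_Zr h hr hr1 (npStep_Sch h h0 a b).1
    · exact key z hz hne

lemma lower {ζ : ℂ} (h : ‖ζ‖ < 1) (h0 : ζ ≠ 0) {f : ℂ → ℂ} (hf : Sch f)
    (hs : ∀ k, ‖((npStep ζ)^[k] f) ζ‖ < 1) {B : ℝ}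
    (hB : ∀ r : ℝ, 0 ≤ r → r < 1 → ∫ t, ph (Zr ζ r t * f (Zr ζ r t)) ∂lam ≤ B) (n : ℕ) :
    ∑ k ∈ Finset.range n, ph (((npStep ζ)^[k] f) ζ) ≤ B := by
  have hev : ∀ᶠ q : ℝ in 𝓝[<] 1, 0 < q ∧ q < 1 := Ioo_mem_nhdsLT one_pos
  have hT : Tendsto (fun q => ∑ k ∈ Finset.range n, ph (Gq ζ f q k ζ)) (𝓝[<] 1)
      (𝓝 (∑ k ∈ Finset.range n, ph (((npStep ζ)^[k] f) ζ))) := by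
    refine tendsto_finsetSum _ fun k _ => ?_
    have hc : ContinuousAt ph (((npStep ζ)^[k] f) ζ) := by
      have hc1 : ContinuousAt (fun s : ℂ => 1 - ‖s‖^2) (((npStep ζ)^[k] f) ζ) := by fun_prop
      exact (hc1.log (one_sub_sq_pos (hs k)).ne').neg
    exact hc.tendsto.comp (Gq_tendsto h h0 hf hs k ζ h)
  refine le_of_tendsto hT ?_
  filter_upwards [hev] with q hq
  have e1 : 0 < 1 - ‖ζ‖ := by linarith
  have e2 : 1 - ‖ζ‖ ≤ 1 := by linarith [norm_nonneg ζ]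
  have e3 : 0 < 1 - q^2 := by nlinarith [hq.1, hq.2]
  have e4 : (1 - ‖ζ‖)^2 ≤ 1 := by nlinarith
  have e5 : 0 < (1 - ‖ζ‖)^2 := by positivity
  set r := Real.sqrt (1 - (1 - q^2) * (1 - ‖ζ‖)^2) with hr
  have e6 : q^2 ≤ 1 - (1 - q^2) * (1 - ‖ζ‖)^2 := by nlinarith
  have hr2 : r^2 = 1 - (1 - q^2) * (1 - ‖ζ‖)^2 := Real.sq_sqrt (by nlinarith [sq_nonneg q])
  have hqr : q ≤ r := Real.le_sqrt_of_sq_le e6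
  have hr0 : 0 ≤ r := Real.sqrt_nonneg _
  have hr1 : r < 1 := by
    have : r^2 < 1 := by rw [hr2]; nlinarith [mul_pos e3 e5]
    nlinarith
  have hZ : ∀ t, q ≤ ‖Zr ζ r t‖ := by
    intro t
    have := one_sub_Zr h hr0 hr1 t
    rw [hr2, sub_sub_cancel, mul_comm (1 - q^2), ← mul_assoc, ← mul_pow, inv_mul_cancel₀ e1.ne',
      one_pow, one_mul] at this
    have h2 : q^2 ≤ ‖Zr ζ r t‖^2 := by linarith
    exact (abs_le_of_sq_le_sq' h2 (norm_nonneg _)).2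
  refine le_trans ?_ (hB r hr0 hr1)
  refine le_trans ?_ (le_trans (lower_aux h h0 hf hq.1.le hqr hr1 n) ?_)
  · refine le_add_of_nonneg_right (integral_nonneg fun t => ?_)
    obtain ⟨a, b⟩ := Gq_Sch h h0 hf hq.1.le hq.2 n
    exact ph_nonneg (Sch_strict h a b (Zr_lt h hr0 hr1 t))
  · have hlt : ∀ z : ℂ, ‖z‖ < 1 → ‖z * f z‖ < 1 := fun z hz => by
      rw [norm_mul]; nlinarith [hf.2 z hz, norm_nonneg z, norm_nonneg (f z)]
    refine integral_mono (int_ph_r h hf hq.1.le hq.2 hr0 hr1) ?_ fun t => ?_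
    · refine int_Zr h hr0 hr1 (g := fun z => ph (z * f z)) (contOn_ph ?_ hlt)
      have := hf.1.continuousOn
      fun_prop
    · refine ph_mono ?_ (hlt _ (Zr_lt h hr0 hr1 t))
      rw [norm_rm hq.1.le, norm_mul]
      exact mul_le_mul_of_nonneg_right (hZ t) (norm_nonneg _)

def RatS (g : ℂ → ℂ) : Prop := ∃ p q : ℂ[X],
  (∀ z : ℂ, ‖z‖ = 1 → ‖p.eval z‖ = ‖q.eval z‖) ∧
  (∀ z : ℂ, ‖z‖ < 1 → q.eval z ≠ 0 ∧ g z = p.eval z / q.eval z)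

lemma RatS_step {ζ : ℂ} (h : ‖ζ‖ < 1) (h0 : ζ ≠ 0) {g : ℂ → ℂ} (hg : Sch g) (h1 : ‖g ζ‖ < 1)
    (hR : RatS (npStep ζ g)) : RatS g := by
  obtain ⟨p, q, hc, hb⟩ := hR
  set γ := g ζ with hγ
  refine ⟨C (om ζ)⁻¹ * (X - C ζ) * p + C γ * ((1 - C (conj ζ) * X) * q),
    (1 - C (conj ζ) * X) * q + C (conj γ) * (C (om ζ)⁻¹ * (X - C ζ) * p), ?_, ?_⟩
  · intro z hz
    simp only [eval_add, eval_mul, eval_sub, eval_C, eval_X, eval_one]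
    have e1 : ‖1 - conj ζ * z‖ = ‖z - ζ‖ := by
      have := norm_mob ζ z
      rw [hz, one_pow, sub_self, mul_zero, sub_eq_zero] at this
      exact (sq_eq_sq₀ (norm_nonneg _) (norm_nonneg _)).1 this
    have e2 : ‖(om ζ)⁻¹ * (z - ζ) * p.eval z‖ = ‖(1 - conj ζ * z) * q.eval z‖ := by
      rw [norm_mul, norm_mul, norm_mul, norm_inv, om_norm h0, hc z hz, e1, inv_one, one_mul]
    generalize (om ζ)⁻¹ * (z - ζ) * p.eval z = B at *
    generalize (1 - conj ζ * z) * q.eval z = A at *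
    have e3 : ‖A + conj γ * B‖^2 - ‖B + γ * A‖^2 = (1 - ‖γ‖^2) * (‖A‖^2 - ‖B‖^2) := by
      simp only [← Complex.normSq_eq_norm_sq, Complex.normSq_apply]
      simp
      ring
    rw [e2, sub_self, mul_zero, sub_eq_zero] at e3
    exact ((sq_eq_sq₀ (norm_nonneg _) (norm_nonneg _)).1 e3).symm
  · intro z hz
    obtain ⟨hq, he⟩ := hb z hz
    simp only [eval_add, eval_mul, eval_sub, eval_C, eval_X, eval_one]
    have h2 : 1 - conj ζ * z ≠ 0 := one_sub_ne h hz.le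
    have h3 := mtrans_npStep h hg h1 hz
    rw [he, mtrans] at h3
    have hn := norm_Nf_le hg h1 hz
    have hd : 1 - conj γ * g z ≠ 0 := one_sub_ne h1 (hg.2 z hz)
    have hN : Nf ζ g z * (1 - conj γ * g z) = g z - γ := by
      rw [Nf, div_mul_cancel₀ _ hd]
    set N := Nf ζ g z
    have hB : (om ζ)⁻¹ * (z - ζ) * p.eval z = N * ((1 - conj ζ * z) * q.eval z) := by
      have h4 : N = (om ζ)⁻¹ * ((z - ζ) / (1 - conj ζ * z) * (p.eval z / q.eval z)) := by
        rw [h3, inv_mul_cancel_left₀ (om_ne h0)]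
      rw [h4, div_mul_div_comm, mul_assoc (om ζ)⁻¹ (_ / _), div_mul_cancel₀ _ (mul_ne_zero h2 hq)]
      ring
    rw [hB]
    have hA : (1 - conj ζ * z) * q.eval z ≠ 0 := mul_ne_zero h2 hq
    generalize (1 - conj ζ * z) * q.eval z = A at *
    have hd2 : 1 + conj γ * N ≠ 0 := by
      have := one_sub_ne (a := -γ) (b := N) (by simpa using h1) hn
      simpa using this
    have hd3 : A + conj γ * (N * A) = A * (1 + conj γ * N) := by ring
    have hne : A + conj γ * (N * A) ≠ 0 := by rw [hd3]; exact mul_ne_zero hA hd2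
    refine ⟨hne, ?_⟩
    rw [eq_div_iff hne]
    linear_combination (-A) * hN

lemma RatS_iter {ζ : ℂ} (h : ‖ζ‖ < 1) (h0 : ζ ≠ 0) {f : ℂ → ℂ} (hf : Sch f) (n : ℕ)
    (hs : ∀ k < n, ‖((npStep ζ)^[k] f) ζ‖ < 1) (hR : RatS ((npStep ζ)^[n] f)) : RatS f := by
  induction n with
  | zero => simpa using hR
  | succ n ih =>
    refine ih (fun k hk => hs k (by omega)) ?_
    rw [Function.iterate_succ_apply'] at hR
    exact RatS_step h h0 (iter_Sch h h0 hf n fun k hk => hs k (by omega)) (hs n (by omega)) hR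

lemma RatS_const {ζ : ℂ} (h : ‖ζ‖ < 1) {g : ℂ → ℂ} (hg : Sch g) (h1 : ‖g ζ‖ = 1) : RatS g := by
  refine ⟨C (g ζ), 1, fun z _ => by simp [h1], fun z hz => ⟨by simp, ?_⟩⟩
  rw [Sch_const h hg h1 hz]; simp

lemma zf_lt {f : ℂ → ℂ} (hf : Sch f) {z : ℂ} (hz : ‖z‖ < 1) : ‖z * f z‖ < 1 := by
  rw [norm_mul]; nlinarith [hf.2 z hz, norm_nonneg z, norm_nonneg (f z)]

lemma IsSchurFn.Sch {ν : Measure ℝ} {f : ℂ → ℂ} (hf : IsSchurFn ν f) : Sch f :=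
  ⟨hf.1, fun z hz => hf.2.1 z (mem_b hz)⟩

lemma reF {ν : Measure ℝ} {f : ℂ → ℂ} (hf : IsSchurFn ν f) {z : ℂ} (hz : ‖z‖ < 1) :
    (Cara ν z).re * ‖1 - z * f z‖^2 = 1 - ‖z * f z‖^2 := by
  have h1 := hf.2.2 z (mem_b hz)
  generalize z * f z = w at *
  generalize Cara ν z = F at *
  have h2 : F * (1 - w) = 1 + w := by linear_combination h1
  have h3 : ((‖1 - w‖^2 : ℝ) : ℂ) = (1 - w) * conj (1 - w) := by
    rw [Complex.mul_conj, Complex.normSq_eq_norm_sq]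
  have h4 : F * ((‖1 - w‖^2 : ℝ) : ℂ) = (1 + w) * conj (1 - w) := by
    rw [h3, ← mul_assoc, h2]
  have h5 := congrArg Complex.re h4
  rw [Complex.re_mul_ofReal] at h5
  rw [h5, ← Complex.normSq_eq_norm_sq, Complex.normSq_apply]
  simp
  ring

lemma ctheta_inj : InjOn ctheta (Ico 0 (2*π)) := by
  intro a ha b hb hab
  unfold ctheta at hab
  obtain ⟨n, hn⟩ := Complex.exp_eq_exp_iff_exists_int.1 hab
  have h1 : (a:ℂ) = b + n * (2*π) := by
    have : ((a:ℂ) - (b + n * (2*π))) * Complex.I = 0 := by linear_combination hn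
    rcases mul_eq_zero.1 this with h | h
    · exact sub_eq_zero.1 h
    · exact absurd h Complex.I_ne_zero
  have h2 : a = b + n * (2*π) := by exact_mod_cast h1
  have hpi := Real.pi_pos
  have h3 : n = 0 := by
    by_contra hne
    rcases lt_or_gt_of_ne hne with h | h
    · have : (n:ℝ) ≤ -1 := by exact_mod_cast (by omega : n ≤ -1)
      nlinarith [ha.1, ha.2, hb.1, hb.2]
    · have : (1:ℝ) ≤ n := by exact_mod_cast (by omega : 1 ≤ n)
      nlinarith [ha.1, ha.2, hb.1, hb.2]
  rw [h2, h3]; simp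

lemma not_RatS {ζ : ℂ} (h : ‖ζ‖ < 1) (ν : Measure ℝ) [IsProbabilityMeasure ν]
    (hcirc : ν (Ico 0 (2*π))ᶜ = 0) (hnt : InfiniteSupport ν) {f : ℂ → ℂ} (hf : IsSchurFn ν f) :
    ¬ RatS f := by
  rintro ⟨p, q, hc, hb⟩
  set D : ℂ[X] := q - X * p with hD
  have hD0 : D ≠ 0 := by
    intro h1
    have := congrArg (eval 0) h1
    simp [hD] at this
    exact (hb 0 (by simp)).1 this
  have c1 : ContinuousOn (fun z : ℂ => ‖D.eval z‖^2) (Metric.closedBall 0 1) := by fun_prop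
  have c2 : ContinuousOn (fun z : ℂ => ‖q.eval z‖^2 - ‖z * p.eval z‖^2) (Metric.closedBall 0 1) := by
    fun_prop
  have w1 := weak_conv h c1 ν
  have w2 := weak_conv' h c2
  have e0 : ∀ θ, ‖q.eval (ctheta θ)‖^2 - ‖ctheta θ * p.eval (ctheta θ)‖^2 = 0 := by
    intro θ
    rw [norm_mul, norm_ctheta, one_mul, hc _ (norm_ctheta θ), sub_self]
  simp only [e0, integral_zero] at w2
  have w3 : Tendsto (fun r => ∫ t, ‖D.eval (Zr ζ r t)‖^2 * (Cara ν (Zr ζ r t)).re ∂lam) (𝓝[<] 1)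
      (𝓝 0) := by
    refine w2.congr' ?_
    filter_upwards [Ioo_mem_nhdsLT one_pos] with r hr
    refine integral_congr_ae (Eventually.of_forall fun t => ?_)
    have hz := Zr_lt h hr.1.le hr.2 t
    have h1 := reF hf hz
    simp only
    generalize Zr ζ r t = z at *
    obtain ⟨a, b⟩ := hb z hz
    have h2 : D.eval z = q.eval z * (1 - z * f z) := by
      rw [b, hD]
      simp only [eval_sub, eval_mul, eval_X]
      field_simp
    have h3 : z * p.eval z = q.eval z * (z * f z) := by
      rw [b]; field_simp
    rw [h2, h3, norm_mul (q.eval z), norm_mul (q.eval z), mul_pow, mul_pow]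
    linear_combination (-‖q.eval z‖^2) * h1
  have e := tendsto_nhds_unique w1 w3
  have hnn : ∀ θ, 0 ≤ ‖D.eval (ctheta θ)‖^2 * pk ζ θ := fun θ =>
    mul_nonneg (by positivity) (pk_pos h θ).le
  have hcont : Continuous fun θ => D.eval (ctheta θ) := D.continuous.comp continuous_ctheta
  obtain ⟨K, hK⟩ := (isCompact_closedBall (0:ℂ) 1).exists_bound_of_continuousOn c1
  have hint : Integrable (fun θ => ‖D.eval (ctheta θ)‖^2 * pk ζ θ) ν := by
    refine (int_pk ν h).bdd_mul (c := K) (hcont.norm.pow 2).aestronglyMeasurable (Eventually.of_forall fun θ => ?_)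
    exact hK _ (by simp [norm_ctheta])
  have ae0 := (integral_eq_zero_iff_of_nonneg hnn hint).1 e
  have hfin : (Ico 0 (2*π) ∩ ctheta ⁻¹' (D.roots.toFinset : Set ℂ)).Finite := by
    refine Set.Finite.of_finite_image (f := ctheta) (Set.Finite.subset (D.roots.toFinset.finite_toSet) ?_)
      (ctheta_inj.mono inter_subset_left)
    rintro _ ⟨x, hx, rfl⟩
    exact hx.2
  refine hnt hfin.toFinset ?_
  have ae1 : ∀ᵐ θ ∂ν, θ ∈ Ico 0 (2*π) := hcirc
  have : ∀ᵐ θ ∂ν, θ ∈ (hfin.toFinset : Set ℝ) := by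
    filter_upwards [ae0, ae1] with θ h1 h2
    rw [hfin.coe_toFinset]
    refine ⟨h2, ?_⟩
    simp only [Pi.zero_apply, mul_eq_zero, (pk_pos h θ).ne', or_false] at h1
    have : D.eval (ctheta θ) = 0 := by simpa using h1
    simp [hD0, this]
  exact this

lemma strict_all {ζ : ℂ} (h : ‖ζ‖ < 1) (h0 : ζ ≠ 0) (ν : Measure ℝ) [IsProbabilityMeasure ν]
    (hcirc : ν (Ico 0 (2*π))ᶜ = 0) (hnt : InfiniteSupport ν) {f : ℂ → ℂ} (hf : IsSchurFn ν f) (n : ℕ) :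
    ‖((npStep ζ)^[n] f) ζ‖ < 1 := by
  induction n using Nat.strong_induction_on with
  | _ n ih =>
    have hS := iter_Sch h h0 hf.Sch n ih
    refine lt_of_le_of_ne (hS.2 ζ h) fun h1 => ?_
    exact not_RatS h ν hcirc hnt hf (RatS_iter h h0 hf.Sch n ih (RatS_const h hS h1))

lemma int_ctheta (ν : Measure ℝ) [IsFiniteMeasure ν] {χ : ℂ → ℝ}
    (hχ : ContinuousOn χ (Metric.closedBall 0 1)) : Integrable (fun θ => χ (ctheta θ)) ν := by
  obtain ⟨C, hC⟩ := (isCompact_closedBall (0:ℂ) 1).exists_bound_of_continuousOn hχ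
  have hm : ∀ θ, ctheta θ ∈ Metric.closedBall (0:ℂ) 1 := fun θ => by simp [norm_ctheta]
  exact Integrable.of_bound (hχ.comp_continuous continuous_ctheta hm).aestronglyMeasurable C
    (Eventually.of_forall fun θ => hC _ (hm θ))

lemma int_log_pk {ζ : ℂ} (h : ‖ζ‖ < 1) (ν : Measure ℝ) [IsFiniteMeasure ν] :
    Integrable (fun θ => Real.log (pk ζ θ)) ν := by
  simp only [log_pk h]
  refine int_ctheta ν (χ := fun z => Real.log (1 - ‖ζ‖^2) - 2 * Real.log ‖1 - conj ζ * z‖) ?_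
  refine continuousOn_const.sub (continuousOn_const.mul (ContinuousOn.log (by fun_prop) fun z hz => ?_))
  exact norm_ne_zero_iff.2 (one_sub_ne h (by simpa using hz))

lemma inv_pk_le {ζ : ℂ} (h : ‖ζ‖ < 1) (θ : ℝ) : ‖(pk ζ θ)⁻¹‖ ≤ 4 / (1 - ‖ζ‖^2) := by
  have h1 := one_sub_sq_pos h
  rw [norm_inv, Real.norm_of_nonneg (pk_pos h θ).le, pk, inv_div]
  gcongr
  have : ‖ctheta θ - ζ‖ ≤ 2 := (norm_sub_le _ _).trans (by rw [norm_ctheta]; linarith)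
  nlinarith [norm_nonneg (ctheta θ - ζ)]

lemma cont_inv_pk {ζ : ℂ} (h : ‖ζ‖ < 1) : Continuous fun θ => (pk ζ θ)⁻¹ :=
  (continuous_pk h).inv₀ fun θ => (pk_pos h θ).ne'

lemma one_sub_zf_re {f : ℂ → ℂ} (hf : Sch f) {z : ℂ} (hz : ‖z‖ < 1) : 0 < (1 - z * f z).re := by
  have h1 : (z * f z).re ≤ ‖z * f z‖ := Complex.re_le_norm _
  have := zf_lt hf hz
  simp only [Complex.sub_re, Complex.one_re]
  linarith

lemma one_sub_zf_ne {f : ℂ → ℂ} (hf : Sch f) {z : ℂ} (hz : ‖z‖ < 1) : 1 - z * f z ≠ 0 := by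
  intro h
  have := one_sub_zf_re hf hz
  rw [h] at this
  simp at this

lemma log_reF {ν : Measure ℝ} {f : ℂ → ℂ} (hf : IsSchurFn ν f) {z : ℂ} (hz : ‖z‖ < 1) :
    -Real.log (Cara ν z).re = ph (z * f z) + 2 * Real.log ‖1 - z * f z‖ := by
  have h1 := reF hf hz
  have h2 := norm_pos_iff.2 (one_sub_zf_ne hf.Sch hz)
  have h3 := one_sub_sq_pos (zf_lt hf.Sch hz)
  have h4 : (Cara ν z).re = (1 - ‖z * f z‖^2) / ‖1 - z * f z‖^2 := by
    rw [eq_div_iff (by positivity)]; exact h1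
  rw [h4, Real.log_div h3.ne' (by positivity), Real.log_pow, ph]
  push_cast
  ring

lemma int_ph_zf {ζ : ℂ} (h : ‖ζ‖ < 1) {f : ℂ → ℂ} (hf : Sch f) {r : ℝ} (hr : 0 ≤ r) (hr1 : r < 1) :
    Integrable (fun t => ph (Zr ζ r t * f (Zr ζ r t))) lam := by
  refine int_Zr h hr hr1 (g := fun z => ph (z * f z)) (contOn_ph ?_ fun z hz => zf_lt hf hz)
  have := hf.1.continuousOn
  fun_prop

lemma int_log_zf {ζ : ℂ} (h : ‖ζ‖ < 1) {f : ℂ → ℂ} (hf : Sch f) {r : ℝ} (hr : 0 ≤ r) (hr1 : r < 1) :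
    Integrable (fun t => Real.log ‖1 - Zr ζ r t * f (Zr ζ r t)‖) lam := by
  refine int_Zr h hr hr1 (g := fun z => Real.log ‖1 - z * f z‖) ?_
  have := hf.1.continuousOn
  refine ContinuousOn.log (by fun_prop) fun z hz => ?_
  exact norm_ne_zero_iff.2 (one_sub_zf_ne hf (of_b hz))

lemma int_log_reF {ζ : ℂ} (h : ‖ζ‖ < 1) {ν : Measure ℝ} {f : ℂ → ℂ} (hf : IsSchurFn ν f)
    {r : ℝ} (hr : 0 ≤ r) (hr1 : r < 1) :
    Integrable (fun t => -Real.log (Cara ν (Zr ζ r t)).re) lam := by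
  have : (fun t => -Real.log (Cara ν (Zr ζ r t)).re) = fun t => ph (Zr ζ r t * f (Zr ζ r t))
      + 2 * Real.log ‖1 - Zr ζ r t * f (Zr ζ r t)‖ := by
    funext t; exact log_reF hf (Zr_lt h hr hr1 t)
  rw [this]
  exact (int_ph_zf h hf.Sch hr hr1).add ((int_log_zf h hf.Sch hr hr1).const_mul 2)

lemma integral_log_reF {ζ : ℂ} (h : ‖ζ‖ < 1) {ν : Measure ℝ} {f : ℂ → ℂ} (hf : IsSchurFn ν f)
    {r : ℝ} (hr : 0 ≤ r) (hr1 : r < 1) :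
    ∫ t, -Real.log (Cara ν (Zr ζ r t)).re ∂lam =
      ∫ t, ph (Zr ζ r t * f (Zr ζ r t)) ∂lam + 2 * Real.log ‖1 - ζ * f ζ‖ := by
  have : (fun t => -Real.log (Cara ν (Zr ζ r t)).re) = fun t => ph (Zr ζ r t * f (Zr ζ r t))
      + 2 * Real.log ‖1 - Zr ζ r t * f (Zr ζ r t)‖ := by
    funext t; exact log_reF hf (Zr_lt h hr hr1 t)
  rw [this, integral_add (int_ph_zf h hf.Sch hr hr1) ((int_log_zf h hf.Sch hr hr1).const_mul 2),
    integral_const_mul]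
  have hd : DifferentiableOn ℂ (fun z => 1 - z * f z) (Metric.ball 0 1) := by
    have := hf.1
    fun_prop
  rw [mean_Zr_log h hr hr1 hd fun z hz => one_sub_zf_re hf.Sch (of_b hz)]

lemma data_proc {ζ : ℂ} (h : ‖ζ‖ < 1) (ν : Measure ℝ) [IsProbabilityMeasure ν]
    (hac : PoisM ζ ≪ ν) (hL : Integrable (llr (PoisM ζ) ν) (PoisM ζ)) {z : ℂ} (hz : ‖z‖ < 1) :
    -Real.log (Cara ν z).re ≤
      ∫ θ, ((pk ζ θ)⁻¹ * (llr (PoisM ζ) ν θ - Real.log (pk ζ θ))) * pk z θ ∂(PoisM ζ) := by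
  have hP := isProb_PoisM h
  set P := PoisM ζ with hPdef
  set L := llr P ν with hLdef
  set t := (Cara ν z).re with ht
  have ht0 : 0 < t := cara_re_pos ν hz
  have iH : Integrable (fun θ => ((pk ζ θ)⁻¹ * (L θ - Real.log (pk ζ θ)))) P :=
    (hL.sub (int_log_pk h P)).bdd_mul (c := 4 / (1 - ‖ζ‖^2)) (cont_inv_pk h).aestronglyMeasurable
      (Eventually.of_forall (inv_pk_le h))
  have bz : ∀ᵐ θ ∂P, ‖pk z θ‖ ≤ 2/(1-‖z‖) := Eventually.of_forall fun θ => by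
    rw [Real.norm_of_nonneg (pk_pos hz θ).le]; exact pk_le hz θ
  have iA : Integrable (fun θ => ((pk ζ θ)⁻¹ * (L θ - Real.log (pk ζ θ))) * pk z θ) P :=
    iH.mul_bdd (continuous_pk hz).aestronglyMeasurable bz
  have hexp : (fun θ => Real.exp (-L θ)) =ᵐ[P] fun θ => (ν.rnDeriv P θ).toReal := exp_neg_llr hac
  have iD : Integrable (fun θ => (ν.rnDeriv P θ).toReal * pk z θ) P :=
    Measure.integrable_toReal_rnDeriv.mul_bdd (continuous_pk hz).aestronglyMeasurable bz
  have leD : ∫ θ, (ν.rnDeriv P θ).toReal * pk z θ ∂P ≤ t := by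
    have e1 := integral_withDensity_eq_integral_toReal_smul (μ := P) (ν.measurable_rnDeriv P)
      (ν.rnDeriv_lt_top P) (pk z)
    simp only [smul_eq_mul] at e1
    rw [← e1, ht, cara_re ν hz]
    exact integral_mono_measure (Measure.withDensity_rnDeriv_le ν P)
      (Eventually.of_forall fun θ => (pk_pos hz θ).le) (int_pk ν hz)
  have iG : Integrable (fun θ => (pk ζ θ)⁻¹ * pk z θ) P :=
    (int_pk P hz).bdd_mul (c := 4 / (1 - ‖ζ‖^2)) (cont_inv_pk h).aestronglyMeasurable
      (Eventually.of_forall (inv_pk_le h))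
  have eG : ∫ θ, (pk ζ θ)⁻¹ * pk z θ ∂P = 1 := by
    rw [hPdef, integral_PoisM h, ← integral_pk hz]
    refine integral_congr_ae (Eventually.of_forall fun θ => ?_)
    have := (pk_pos h θ).ne'
    simp only
    field_simp
  have key : ∫ θ, -(((pk ζ θ)⁻¹ * (L θ - Real.log (pk ζ θ))) * pk z θ) ∂P ≤
      ∫ θ, (t⁻¹ * ((ν.rnDeriv P θ).toReal * pk z θ) + (Real.log t - 1) * ((pk ζ θ)⁻¹ * pk z θ)) ∂P := by
    refine integral_mono_ae iA.neg ((iD.const_mul _).add (iG.const_mul _)) ?_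
    filter_upwards [hexp] with θ hθ
    rw [← hθ]
    have p1 := pk_pos h θ
    have p2 := pk_pos hz θ
    have p3 := Real.exp_pos (-L θ)
    have l1 := Real.log_le_sub_one_of_pos (show 0 < pk ζ θ * Real.exp (-L θ) / t by positivity)
    rw [Real.log_div (by positivity) ht0.ne', Real.log_mul p1.ne' p3.ne', Real.log_exp] at l1
    have l2 : -(L θ - Real.log (pk ζ θ)) ≤ pk ζ θ * Real.exp (-L θ) / t + (Real.log t - 1) := by
      linarith
    have l3 := mul_le_mul_of_nonneg_left l2 (show 0 ≤ (pk ζ θ)⁻¹ * pk z θ by positivity)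
    calc _ = (pk ζ θ)⁻¹ * pk z θ * -(L θ - Real.log (pk ζ θ)) := by ring
      _ ≤ _ := l3
      _ = _ := by field_simp
  rw [integral_neg, integral_add (iD.const_mul _) (iG.const_mul _), integral_const_mul,
    integral_const_mul, eG] at key
  have := mul_le_mul_of_nonneg_left leD (inv_nonneg.2 ht0.le)
  rw [inv_mul_cancel₀ ht0.ne'] at this
  linarith

lemma data_proc_int {ζ : ℂ} (h : ‖ζ‖ < 1) (ν : Measure ℝ) [IsProbabilityMeasure ν]
    (hac : PoisM ζ ≪ ν) (hL : Integrable (llr (PoisM ζ) ν) (PoisM ζ))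
    {f : ℂ → ℂ} (hf : IsSchurFn ν f) {r : ℝ} (hr : 0 ≤ r) (hr1 : r < 1) :
    ∫ t, -Real.log (Cara ν (Zr ζ r t)).re ∂lam ≤
      ∫ θ, llr (PoisM ζ) ν θ ∂(PoisM ζ) + Real.log (1 - ‖ζ‖^2) := by
  have hP := isProb_PoisM h
  set P := PoisM ζ with hPdef
  have iH : Integrable (fun θ => ((pk ζ θ)⁻¹ * (llr P ν θ - Real.log (pk ζ θ)))) P :=
    (hL.sub (int_log_pk h P)).bdd_mul (c := 4 / (1 - ‖ζ‖^2)) (cont_inv_pk h).aestronglyMeasurable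
      (Eventually.of_forall (inv_pk_le h))
  have c1 : ContinuousOn (fun _ : ℂ => (1:ℝ)) (Metric.closedBall 0 1) := continuousOn_const
  have F := fub h hr hr1 P iH c1
  have I := (fub_int h hr hr1 P iH c1).integral_prod_right
  simp only [one_mul] at F I
  have e : ∀ θ, (pk ζ θ)⁻¹ * (llr P ν θ - Real.log (pk ζ θ)) * ∫ t, pk (Zr ζ r t) θ ∂lam
      = llr P ν θ - Real.log (pk ζ θ) := by
    intro θ
    rw [mean_pk h hr hr1]
    have := (pk_pos h θ).ne'
    field_simp
  simp only [e] at F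
  rw [integral_sub hL (int_log_pk h P), integral_log_pk h] at F
  have := integral_mono (int_log_reF h hf hr hr1) I fun t => data_proc h ν hac hL (Zr_lt h hr hr1 t)
  rw [F] at this
  linarith

lemma part_one {ζ : ℂ} (h : ‖ζ‖ < 1) (h0 : ζ ≠ 0) (ν : Measure ℝ) [IsProbabilityMeasure ν]
    (hac : PoisM ζ ≪ ν) (hL : Integrable (llr (PoisM ζ) ν) (PoisM ζ))
    {f : ℂ → ℂ} (hf : IsSchurFn ν f) (hs : ∀ k, ‖((npStep ζ)^[k] f) ζ‖ < 1) (n : ℕ) :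
    2 * Real.log ‖1 - ζ * f ζ‖ - Real.log (1 - ‖ζ‖^2)
      + ∑ k ∈ Finset.range n, ph (((npStep ζ)^[k] f) ζ) ≤ ∫ θ, llr (PoisM ζ) ν θ ∂(PoisM ζ) := by
  have := lower h h0 hf.Sch hs (B := ∫ θ, llr (PoisM ζ) ν θ ∂(PoisM ζ) + Real.log (1 - ‖ζ‖^2)
    - 2 * Real.log ‖1 - ζ * f ζ‖) (fun r hr hr1 => by
      have := data_proc_int h ν hac hL hf hr hr1
      rw [integral_log_reF h hf hr hr1] at this
      linarith) n
  linarith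

lemma lsc_cont {ζ : ℂ} (h : ‖ζ‖ < 1) (ν : Measure ℝ) [IsProbabilityMeasure ν]
    {f : ℂ → ℂ} (hf : IsSchurFn ν f) {C : ℝ}
    (hC : ∀ r : ℝ, 0 ≤ r → r < 1 → ∫ t, -Real.log (Cara ν (Zr ζ r t)).re ∂lam ≤ C)
    {g : ℂ → ℝ} (hg : Continuous g) :
    1 + ∫ θ, g (ctheta θ) ∂(PoisM ζ) - ∫ θ, Real.exp (g (ctheta θ)) * pk ζ θ ∂ν ≤ C := by
  have w1 := weak_conv h (χ := fun z => Real.exp (g z)) (by fun_prop) ν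
  have w2 := weak_conv' h (χ := g) hg.continuousOn
  refine le_of_tendsto ((tendsto_const_nhds.add w2).sub w1) ?_
  filter_upwards [Ioo_mem_nhdsLT one_pos] with r hr
  refine le_trans ?_ (hC r hr.1.le hr.2)
  have i1 : Integrable (fun t => g (Zr ζ r t)) lam := int_Zr h hr.1.le hr.2 hg.continuousOn
  have cF : ContinuousOn (fun z => (Cara ν z).re) (Metric.ball 0 1) := by
    refine ContinuousOn.congr (f := fun z => (1 - ‖z * f z‖^2) / ‖1 - z * f z‖^2) ?_ ?_
    · have := hf.1.continuousOn
      refine ContinuousOn.div (by fun_prop) (by fun_prop) fun z hz => ?_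
      exact pow_ne_zero 2 (norm_ne_zero_iff.2 (one_sub_zf_ne hf.Sch (of_b hz)))
    · intro z hz
      have := norm_pos_iff.2 (one_sub_zf_ne hf.Sch (of_b hz))
      exact (eq_div_iff (by positivity)).2 (reF hf (of_b hz))
  have i2 : Integrable (fun t => Real.exp (g (Zr ζ r t)) * (Cara ν (Zr ζ r t)).re) lam :=
    int_Zr h hr.1.le hr.2 (g := fun z => Real.exp (g z) * (Cara ν z).re) (by fun_prop)
  have e1 : (1:ℝ) = ∫ t, (1:ℝ) ∂lam := by simp
  rw [e1, ← integral_add (integrable_const _) i1, ← integral_sub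
    (by exact (integrable_const _).add i1) i2]
  refine integral_mono (((integrable_const _).add i1).sub i2) (int_log_reF h hf hr.1.le hr.2) fun t => ?_
  have p := cara_re_pos ν (Zr_lt h hr.1.le hr.2 t)
  have l := Real.log_le_sub_one_of_pos (mul_pos (Real.exp_pos (g (Zr ζ r t))) p)
  rw [Real.log_mul (Real.exp_pos _).ne' p.ne', Real.log_exp] at l
  simp only
  linarith

/-- inverse of `ctheta` -/
def ith (z : ℂ) : ℝ := if 0 ≤ Complex.arg z then Complex.arg z else Complex.arg z + 2*π

lemma meas_ith : Measurable ith := by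
  unfold ith
  exact Measurable.ite (measurableSet_le measurable_const Complex.measurable_arg)
    Complex.measurable_arg (Complex.measurable_arg.add_const _)

lemma ith_mem (z : ℂ) : ith z ∈ Ico 0 (2*π) := by
  have h1 := Complex.neg_pi_lt_arg z
  have h2 := Complex.arg_le_pi z
  have h3 := Real.pi_pos
  unfold ith
  split_ifs with h
  · exact ⟨h, by linarith⟩
  · exact ⟨by linarith, by push Not at h; linarith⟩

lemma ctheta_ith {z : ℂ} (hz : ‖z‖ = 1) : ctheta (ith z) = z := by
  have h1 := Complex.norm_mul_exp_arg_mul_I z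
  rw [hz, Complex.ofReal_one, one_mul] at h1
  unfold ctheta ith
  split_ifs
  · exact h1
  · push_cast
    rw [add_mul, Complex.exp_add, h1, Complex.exp_two_pi_mul_I, mul_one]

lemma ith_ctheta {θ : ℝ} (h : θ ∈ Ico 0 (2*π)) : ith (ctheta θ) = θ :=
  ctheta_inj (ith_mem _) h (ctheta_ith (norm_ctheta θ))

lemma exp_lip {M a b : ℝ} (ha : a ≤ M) (hb : b ≤ M) :
    Real.exp a - Real.exp b ≤ Real.exp M * |a - b| := by
  rcases le_total a b with hab | hab
  · have := Real.exp_le_exp.2 hab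
    have : 0 ≤ Real.exp M * |a - b| := by positivity
    linarith
  · rw [abs_of_nonneg (by linarith)]
    have h1 : Real.exp b = Real.exp a * Real.exp (b - a) := by rw [← Real.exp_add]; ring_nf
    have h2 := Real.add_one_le_exp (b - a)
    have h3 := Real.exp_le_exp.2 ha
    have h4 := Real.exp_pos a
    nlinarith

lemma clip_dist {M x y : ℝ} (hx : |x| ≤ M) : |x - max (-M) (min M y)| ≤ |x - y| := by
  obtain ⟨h1, h2⟩ := abs_le.1 hx
  rcases le_total M y with h | h
  · rw [min_eq_left h, max_eq_right (by linarith), abs_of_nonpos (by linarith),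
      abs_of_nonpos (by linarith)]
    linarith
  · rw [min_eq_right h]
    rcases le_total (-M) y with h' | h'
    · rw [max_eq_right h']
    · rw [max_eq_left h', abs_of_nonneg (by linarith), abs_of_nonneg (by linarith)]
      linarith

lemma P_ae {ζ : ℂ} (h : ‖ζ‖ < 1) : ∀ᵐ θ ∂(PoisM ζ), θ ∈ Ico 0 (2*π) := by
  have h1 : ∀ᵐ θ ∂lam, θ ∈ Ico 0 (2*π) := lam_compl
  rw [PoisM_eq ζ h]
  exact (withDensity_absolutelyContinuous _ _).ae_le h1

lemma lsc_meas {ζ : ℂ} (h : ‖ζ‖ < 1) (ν : Measure ℝ) [IsProbabilityMeasure ν]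
    (hcirc : ν (Ico 0 (2*π))ᶜ = 0)
    {f : ℂ → ℂ} (hf : IsSchurFn ν f) {C : ℝ}
    (hC : ∀ r : ℝ, 0 ≤ r → r < 1 → ∫ t, -Real.log (Cara ν (Zr ζ r t)).re ∂lam ≤ C)
    {ψ : ℝ → ℝ} (hψ : Measurable ψ) {M : ℝ} (hM : ∀ θ, |ψ θ| ≤ M) :
    1 + ∫ θ, ψ θ ∂(PoisM ζ) - ∫ θ, Real.exp (ψ θ) * pk ζ θ ∂ν ≤ C := by
  have hP := isProb_PoisM h
  have hcm : Measurable ctheta := continuous_ctheta.measurable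
  set P := PoisM ζ with hPdef
  set Q := (P + ν).map ctheta with hQ
  have hm2 : Measurable fun z => ψ (ith z) := hψ.comp meas_ith
  have hi : Integrable (fun z => ψ (ith z)) Q :=
    Integrable.of_bound hm2.aestronglyMeasurable M (Eventually.of_forall fun z => hM _)
  have hM0 : 0 ≤ M := (abs_nonneg _).trans (hM 0)
  set K := 2/(1-‖ζ‖) with hK
  have hK0 : 0 ≤ K := div_nonneg zero_le_two (by linarith)
  have key : ∀ ε : ℝ, 0 < ε →
      1 + ∫ θ, ψ θ ∂P - ∫ θ, Real.exp (ψ θ) * pk ζ θ ∂ν ≤ C + (1 + Real.exp M * K) * ε := by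
    intro ε hε
    obtain ⟨g, hg, hgi⟩ := hi.exists_boundedContinuous_integral_sub_le hε
    set G : ℂ → ℝ := fun z => max (-M) (min M (g z)) with hG
    have hGc : Continuous G := by
      have := g.continuous
      fun_prop
    have hGm : Measurable fun θ => G (ctheta θ) := hGc.measurable.comp hcm
    have hGb : ∀ z, |G z| ≤ M := fun z => by
      rw [abs_le]
      exact ⟨le_max_left _ _, max_le (by linarith) (min_le_left _ _)⟩
    have L := lsc_cont h ν hf hC hGc
    -- transfer
    have hms : AEStronglyMeasurable (fun z => ‖ψ (ith z) - g z‖) ((P + ν).map ctheta) :=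
      (hm2.sub g.continuous.measurable).norm.aestronglyMeasurable
    rw [hQ, integral_map hcm.aemeasurable hms] at hg
    have d0 : Integrable (fun θ => ‖ψ (ith (ctheta θ)) - g (ctheta θ)‖) (P + ν) := by
      have := (hi.sub hgi).norm
      rw [hQ] at this
      exact (integrable_map_measure this.aestronglyMeasurable hcm.aemeasurable).1 this
    rw [integral_add_measure d0.left_of_add_measure d0.right_of_add_measure] at hg
    have n1 : 0 ≤ ∫ θ, ‖ψ (ith (ctheta θ)) - g (ctheta θ)‖ ∂P := integral_nonneg fun _ => norm_nonneg _
    have n2 : 0 ≤ ∫ θ, ‖ψ (ith (ctheta θ)) - g (ctheta θ)‖ ∂ν := integral_nonneg fun _ => norm_nonneg _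
    have aeP : ∀ᵐ θ ∂P, θ ∈ Ico 0 (2*π) := P_ae h
    have aeν : ∀ᵐ θ ∂ν, θ ∈ Ico 0 (2*π) := hcirc
    have iψ : ∀ (m : Measure ℝ) [IsFiniteMeasure m], Integrable ψ m := fun m _ =>
      Integrable.of_bound hψ.aestronglyMeasurable M (Eventually.of_forall fun z => hM _)
    have iG : ∀ (m : Measure ℝ) [IsFiniteMeasure m], Integrable (fun θ => G (ctheta θ)) m := fun m _ =>
      Integrable.of_bound hGm.aestronglyMeasurable M (Eventually.of_forall fun z => hGb _)
    have b1 : ∫ θ, ψ θ ∂P - ∫ θ, G (ctheta θ) ∂P ≤ ε := by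
      rw [← integral_sub (iψ P) (iG P)]
      refine le_trans ?_ (le_trans (le_add_of_nonneg_right n2) hg)
      refine integral_mono_ae ((iψ P).sub (iG P)) d0.left_of_add_measure ?_
      filter_upwards [aeP] with θ hθ
      rw [ith_ctheta hθ, Real.norm_eq_abs]
      exact (le_abs_self _).trans (clip_dist (hM θ))
    have iE1 : Integrable (fun θ => Real.exp (ψ θ) * pk ζ θ) ν := by
      refine (int_pk ν h).bdd_mul (c := Real.exp M) hψ.exp.aestronglyMeasurable
        (Eventually.of_forall fun θ => ?_)
      rw [Real.norm_of_nonneg (Real.exp_pos _).le]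
      exact Real.exp_le_exp.2 (abs_le.1 (hM θ)).2
    have iE2 : Integrable (fun θ => Real.exp (G (ctheta θ)) * pk ζ θ) ν := by
      refine (int_pk ν h).bdd_mul (c := Real.exp M) hGm.exp.aestronglyMeasurable
        (Eventually.of_forall fun θ => ?_)
      rw [Real.norm_of_nonneg (Real.exp_pos _).le]
      exact Real.exp_le_exp.2 (abs_le.1 (hGb _)).2
    have b2 : ∫ θ, Real.exp (G (ctheta θ)) * pk ζ θ ∂ν - ∫ θ, Real.exp (ψ θ) * pk ζ θ ∂ν ≤
        Real.exp M * K * ε := by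
      rw [← integral_sub iE2 iE1]
      refine le_trans ?_ (mul_le_mul_of_nonneg_left (le_trans (le_add_of_nonneg_left n1) hg)
        (mul_nonneg (Real.exp_pos M).le hK0))
      rw [← integral_const_mul]
      refine integral_mono_ae (iE2.sub iE1) (d0.right_of_add_measure.const_mul _) ?_
      filter_upwards [aeν] with θ hθ
      rw [ith_ctheta hθ, Real.norm_eq_abs]
      have q1 := exp_lip (abs_le.1 (hGb (ctheta θ))).2 (abs_le.1 (hM θ)).2
      have q2 : |G (ctheta θ) - ψ θ| ≤ |ψ θ - g (ctheta θ)| := by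
        rw [abs_sub_comm]; exact clip_dist (hM θ)
      have q3 := pk_pos h θ
      have q4 := pk_le h θ
      calc Real.exp (G (ctheta θ)) * pk ζ θ - Real.exp (ψ θ) * pk ζ θ
          = (Real.exp (G (ctheta θ)) - Real.exp (ψ θ)) * pk ζ θ := by ring
        _ ≤ (Real.exp M * |G (ctheta θ) - ψ θ|) * pk ζ θ := by gcongr
        _ ≤ (Real.exp M * |ψ θ - g (ctheta θ)|) * K := by gcongr
        _ = _ := by ring
    linarith
  have hT : Tendsto (fun ε : ℝ => C + (1 + Real.exp M * K) * ε) (𝓝[>] 0)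
      (𝓝 (C + (1 + Real.exp M * K) * 0)) := by
    refine (Continuous.tendsto (by fun_prop) 0).mono_left nhdsWithin_le_nhds
  rw [mul_zero, add_zero] at hT
  refine ge_of_tendsto hT ?_
  filter_upwards [self_mem_nhdsWithin] with ε hε
  exact key ε hε

lemma lsc_ac {ζ : ℂ} (h : ‖ζ‖ < 1) (ν : Measure ℝ) [IsProbabilityMeasure ν]
    (hcirc : ν (Ico 0 (2*π))ᶜ = 0)
    {f : ℂ → ℂ} (hf : IsSchurFn ν f) {C : ℝ}
    (hC : ∀ r : ℝ, 0 ≤ r → r < 1 → ∫ t, -Real.log (Cara ν (Zr ζ r t)).re ∂lam ≤ C) :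
    PoisM ζ ≪ ν := by
  have hP := isProb_PoisM h
  refine Measure.AbsolutelyContinuous.mk fun E hE hν => ?_
  have key : ∀ n : ℕ, (n:ℝ) * (PoisM ζ).real E ≤ C - 1 + ∫ θ, pk ζ θ ∂ν := by
    intro n
    have hm : Measurable (E.indicator fun _ : ℝ => (n:ℝ)) := measurable_const.indicator hE
    have := lsc_meas h ν hcirc hf hC hm (M := n) fun θ => by
      by_cases hθ : θ ∈ E <;> simp [hθ]
    rw [integral_indicator_const _ hE, smul_eq_mul] at this
    have e : ∫ θ, Real.exp (E.indicator (fun _ : ℝ => (n:ℝ)) θ) * pk ζ θ ∂ν = ∫ θ, pk ζ θ ∂ν := by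
      refine integral_congr_ae ?_
      have hE' : ∀ᵐ θ ∂ν, θ ∉ E := measure_eq_zero_iff_ae_notMem.1 hν
      filter_upwards [hE'] with θ hθ
      simp [hθ]
    rw [e] at this
    linarith
  by_contra hne
  have hpos : 0 < (PoisM ζ).real E := by
    rw [measureReal_def]
    exact ENNReal.toReal_pos hne (measure_ne_top _ _)
  obtain ⟨n, hn⟩ := exists_nat_gt ((C - 1 + ∫ θ, pk ζ θ ∂ν) / (PoisM ζ).real E)
  rw [div_lt_iff₀ hpos] at hn
  exact absurd (key n) (not_le.2 hn)

lemma log_clip {m x : ℝ} (hx : 0 < x) :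
    Real.log (max (Real.exp (-m)) (min (Real.exp m) x)) = max (-m) (min m (Real.log x)) := by
  have : max (Real.exp (-m)) (min (Real.exp m) x) = Real.exp (max (-m) (min m (Real.log x))) := by
    rw [Real.exp_monotone.map_max, Real.exp_monotone.map_min, Real.exp_log hx]
  rw [this, Real.log_exp]

lemma log_pk_bdd {ζ : ℂ} (h : ‖ζ‖ < 1) : ∃ B, ∀ θ, |Real.log (pk ζ θ)| ≤ B := by
  refine ⟨max (Real.log (2/(1-‖ζ‖))) (Real.log (4 / (1 - ‖ζ‖^2))), fun θ => ?_⟩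
  have p := pk_pos h θ
  rw [abs_le]
  constructor
  · have h1 := inv_pk_le h θ
    rw [Real.norm_of_nonneg (inv_nonneg.2 p.le)] at h1
    have := Real.log_le_log (inv_pos.2 p) h1
    rw [Real.log_inv] at this
    linarith [le_max_right (Real.log (2/(1-‖ζ‖))) (Real.log (4 / (1 - ‖ζ‖^2)))]
  · exact (Real.log_le_log p (pk_le h θ)).trans (le_max_left _ _)

lemma lsc_clip {ζ : ℂ} (h : ‖ζ‖ < 1) (ν : Measure ℝ) [IsProbabilityMeasure ν]
    (hcirc : ν (Ico 0 (2*π))ᶜ = 0)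
    {f : ℂ → ℂ} (hf : IsSchurFn ν f) {C : ℝ}
    (hC : ∀ r : ℝ, 0 ≤ r → r < 1 → ∫ t, -Real.log (Cara ν (Zr ζ r t)).re ∂lam ≤ C) {m : ℝ}
    (hm : 0 ≤ m) :
    ∫ θ, max (-m) (min m (llr (PoisM ζ) ν θ)) ∂(PoisM ζ) ≤
      C - Real.log (1 - ‖ζ‖^2) + Real.exp (-m) := by
  have hP := isProb_PoisM h
  have hac := lsc_ac h ν hcirc hf hC
  obtain ⟨B, hB⟩ := log_pk_bdd h
  have hlp := integral_log_pk h
  set P := PoisM ζ with hPdef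
  set D : ℝ → ℝ := fun θ => (P.rnDeriv ν θ).toReal with hD
  have hDm : Measurable D := (P.measurable_rnDeriv ν).ennreal_toReal
  set k : ℝ → ℝ := fun θ => max (Real.exp (-m)) (min (Real.exp m) (D θ)) with hk
  have hkm : Measurable k := measurable_const.max (measurable_const.min hDm)
  have hk0 : ∀ θ, 0 < k θ := fun θ => lt_of_lt_of_le (Real.exp_pos _) (le_max_left _ _)
  have hkl : ∀ θ, |Real.log (k θ)| ≤ m := fun θ => by
    have e1 : Real.exp (-m) ≤ k θ := le_max_left _ _
    have e2 : k θ ≤ Real.exp m :=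
      max_le (Real.exp_le_exp.2 (by linarith)) (min_le_left _ _)
    have := Real.log_le_log (Real.exp_pos _) e1
    have h2 := Real.log_le_log (hk0 θ) e2
    rw [Real.log_exp] at this h2
    exact abs_le.2 ⟨this, h2⟩
  have L := lsc_meas h ν hcirc hf hC (ψ := fun θ => Real.log (k θ) - Real.log (pk ζ θ))
    (hkm.log.sub (continuous_pk h).measurable.log) (M := m + B)
    fun θ => (abs_sub _ _).trans (add_le_add (hkl θ) (hB θ))
  have ik : Integrable (fun θ => Real.log (k θ)) P :=
    Integrable.of_bound hkm.log.aestronglyMeasurable m (Eventually.of_forall hkl)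
  rw [integral_sub ik (int_log_pk h P), hlp] at L
  have e1 : ∀ θ, Real.exp (Real.log (k θ) - Real.log (pk ζ θ)) * pk ζ θ = k θ := fun θ => by
    rw [Real.exp_sub, Real.exp_log (hk0 θ), Real.exp_log (pk_pos h θ), div_mul_cancel₀ _ (pk_pos h θ).ne']
  simp only [e1] at L
  have iD : Integrable D ν := Measure.integrable_toReal_rnDeriv
  have e2 : ∫ θ, k θ ∂ν ≤ Real.exp (-m) + 1 := by
    have e3 : ∫ θ, D θ ∂ν = 1 := by
      rw [hD, Measure.integral_toReal_rnDeriv hac]; simp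
    have e4 : ∫ θ, (Real.exp (-m) + D θ) ∂ν = Real.exp (-m) + 1 := by
      rw [integral_add (integrable_const _) iD, e3]; simp
    rw [← e4]
    have b : ∀ θ, k θ ≤ Real.exp (-m) + D θ := fun θ => by
      have d0 : 0 ≤ D θ := ENNReal.toReal_nonneg
      refine max_le (by linarith) ((min_le_right _ _).trans ?_)
      linarith [Real.exp_pos (-m)]
    refine integral_mono ?_ ((integrable_const _).add iD) b
    refine Integrable.of_bound hkm.aestronglyMeasurable (Real.exp m) (Eventually.of_forall fun θ => ?_)
    rw [Real.norm_of_nonneg (hk0 θ).le]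
    exact max_le (Real.exp_le_exp.2 (by linarith)) (min_le_left _ _)
  have e5 : ∫ θ, max (-m) (min m (llr P ν θ)) ∂P = ∫ θ, Real.log (k θ) ∂P := by
    refine integral_congr_ae ?_
    filter_upwards [Measure.rnDeriv_pos hac, hac.ae_le (P.rnDeriv_lt_top ν)] with θ h1 h2
    exact (log_clip (ENNReal.toReal_pos h1.ne' h2.ne)).symm
  rw [e5]
  linarith

lemma part_two {ζ : ℂ} (h : ‖ζ‖ < 1) (ν : Measure ℝ) [IsProbabilityMeasure ν]
    (hcirc : ν (Ico 0 (2*π))ᶜ = 0)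
    {f : ℂ → ℂ} (hf : IsSchurFn ν f) {C : ℝ}
    (hC : ∀ r : ℝ, 0 ≤ r → r < 1 → ∫ t, -Real.log (Cara ν (Zr ζ r t)).re ∂lam ≤ C) :
    PoisM ζ ≪ ν ∧ Integrable (llr (PoisM ζ) ν) (PoisM ζ) ∧
      ∫ θ, llr (PoisM ζ) ν θ ∂(PoisM ζ) ≤ C - Real.log (1 - ‖ζ‖^2) := by
  have hP := isProb_PoisM h
  have hac := lsc_ac h ν hcirc hf hC
  have hcl := fun n : ℕ => lsc_clip h ν hcirc hf hC (m := n) n.cast_nonneg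
  set P := PoisM ζ with hPdef
  set L := llr P ν with hLdef
  have hLm : Measurable L := measurable_llr P ν
  set A := C - Real.log (1 - ‖ζ‖^2) with hA
  have iE : Integrable (fun θ => Real.exp (-L θ)) P :=
    (integrable_congr (exp_neg_llr hac)).2 Measure.integrable_toReal_rnDeriv
  set K := ∫ θ, Real.exp (-L θ) ∂P with hK
  set u : ℕ → ℝ → ℝ := fun n θ => max (-(n:ℝ)) (min n (L θ)) + Real.exp (-L θ) with hu
  have hcm : ∀ n : ℕ, Measurable fun θ => max (-(n:ℝ)) (min n (L θ)) := fun n =>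
    measurable_const.max (measurable_const.min hLm)
  have hum : ∀ n, Measurable (u n) := fun n => (hcm n).add hLm.neg.exp
  have ic : ∀ n : ℕ, Integrable (fun θ => max (-(n:ℝ)) (min n (L θ))) P := fun n => by
    refine Integrable.of_bound (hcm n).aestronglyMeasurable n (Eventually.of_forall fun θ => ?_)
    rw [Real.norm_eq_abs, abs_le]
    have : (0:ℝ) ≤ n := n.cast_nonneg
    exact ⟨le_max_left _ _, max_le (by linarith) (min_le_left _ _)⟩
  have iu : ∀ n, Integrable (u n) P := fun n => (ic n).add iE
  have hu0 : ∀ n θ, 0 ≤ u n θ := fun n θ => by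
    have h1 := Real.add_one_le_exp (-L θ)
    have h2 := Real.exp_pos (-L θ)
    have h3 : min 0 (L θ) ≤ max (-(n:ℝ)) (min n (L θ)) :=
      (min_le_min_right _ n.cast_nonneg).trans (le_max_right _ _)
    simp only [hu]
    rcases le_total 0 (L θ) with h4 | h4
    · rw [min_eq_left h4] at h3; linarith
    · rw [min_eq_right h4] at h3; linarith
  have iub : ∀ n, ∫ θ, u n θ ∂P ≤ A + Real.exp (-(n:ℝ)) + K := fun n => by
    have := integral_add (ic n) iE
    simp only [hu]
    rw [this]
    linarith [hcl n]
  have hlim : ∀ θ, Tendsto (fun n => u n θ) atTop (𝓝 (L θ + Real.exp (-L θ))) := fun θ => by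
    refine Tendsto.add_const _ (tendsto_const_nhds.congr' ?_)
    obtain ⟨N, hN⟩ := exists_nat_ge |L θ|
    filter_upwards [eventually_ge_atTop N] with n hn
    have : |L θ| ≤ n := hN.trans (by exact_mod_cast hn)
    obtain ⟨a, b⟩ := abs_le.1 this
    rw [min_eq_right b, max_eq_right a]
  have hV0 : ∀ θ, 0 ≤ L θ + Real.exp (-L θ) := fun θ => by
    linarith [Real.add_one_le_exp (-L θ)]
  have fat : ∫⁻ θ, ENNReal.ofReal (L θ + Real.exp (-L θ)) ∂P ≤ ENNReal.ofReal (A + K) := by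
    have f1 := lintegral_liminf_le (μ := P) (u := atTop) (f := fun n θ => ENNReal.ofReal (u n θ))
      fun n => (hum n).ennreal_ofReal
    have f2 : ∀ θ, liminf (fun n => ENNReal.ofReal (u n θ)) atTop
        = ENNReal.ofReal (L θ + Real.exp (-L θ)) := fun θ =>
      (ENNReal.tendsto_ofReal (hlim θ)).liminf_eq
    simp only [f2] at f1
    refine f1.trans ?_
    have f3 : Tendsto (fun n : ℕ => ENNReal.ofReal (A + Real.exp (-(n:ℝ)) + K)) atTop
        (𝓝 (ENNReal.ofReal (A + 0 + K))) := by
      refine ENNReal.tendsto_ofReal (Tendsto.add_const _ (Tendsto.const_add _ ?_))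
      exact Real.tendsto_exp_neg_atTop_nhds_zero.comp tendsto_natCast_atTop_atTop
    rw [add_zero] at f3
    rw [← f3.liminf_eq]
    refine liminf_le_liminf (Eventually.of_forall fun n => ?_)
    rw [← ofReal_integral_eq_lintegral_ofReal (iu n) (Eventually.of_forall (hu0 n))]
    exact ENNReal.ofReal_le_ofReal (iub n)
  have hVm : Measurable fun θ => L θ + Real.exp (-L θ) := hLm.add hLm.neg.exp
  have iV : Integrable (fun θ => L θ + Real.exp (-L θ)) P := by
    refine ⟨hVm.aestronglyMeasurable, ?_⟩
    rw [hasFiniteIntegral_iff_ofReal (Eventually.of_forall hV0)]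
    exact fat.trans_lt ENNReal.ofReal_lt_top
  have iL : Integrable L P := by
    have := iV.sub iE
    refine this.congr (Eventually.of_forall fun θ => ?_)
    simp
  have hAK : 0 ≤ A + K := by
    have h1 : ∀ n : ℕ, 0 ≤ A + Real.exp (-(n:ℝ)) + K := fun n =>
      (integral_nonneg (hu0 n)).trans (iub n)
    have f3 : Tendsto (fun n : ℕ => A + Real.exp (-(n:ℝ)) + K) atTop (𝓝 (A + 0 + K)) :=
      Tendsto.add_const _ (Tendsto.const_add _
        (Real.tendsto_exp_neg_atTop_nhds_zero.comp tendsto_natCast_atTop_atTop))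
    rw [add_zero] at f3
    exact ge_of_tendsto' f3 h1
  refine ⟨hac, iL, ?_⟩
  rw [← ofReal_integral_eq_lintegral_ofReal iV (Eventually.of_forall hV0),
    ENNReal.ofReal_le_ofReal_iff hAK, integral_add iL iE] at fat
  linarith

lemma const_eq {ζ w : ℂ} (h : ‖ζ‖ < 1) (hw : ‖w‖ < 1) (hne : 1 - ζ * w ≠ 0) :
    -Real.log (1 - ‖mtrans (conj ζ) w‖^2) =
      2 * Real.log ‖1 - ζ * w‖ - Real.log (1 - ‖ζ‖^2) + ph w := by
  have e := norm_mob (conj ζ) w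
  rw [Complex.conj_conj, Complex.norm_conj] at e
  have p : 0 < ‖1 - ζ * w‖ := norm_pos_iff.2 hne
  have p1 := one_sub_sq_pos h
  have p2 := one_sub_sq_pos hw
  have e2 : 1 - ‖mtrans (conj ζ) w‖^2 = (1 - ‖ζ‖^2) * (1 - ‖w‖^2) / ‖1 - ζ * w‖^2 := by
    unfold mtrans
    rw [Complex.conj_conj, norm_div, div_pow, ← e]
    rw [sub_div, div_self (pow_pos p 2).ne']
  rw [e2, Real.log_div (mul_pos p1 p2).ne' (pow_pos p 2).ne', Real.log_mul p1.ne' p2.ne',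
    Real.log_pow]
  unfold ph
  push_cast
  ring

lemma hC_of {ζ : ℂ} (h : ‖ζ‖ < 1) (h0 : ζ ≠ 0) (ν : Measure ℝ) [IsProbabilityMeasure ν]
    {f : ℂ → ℂ} (hf : IsSchurFn ν f) (hs : ∀ n, ‖((npStep ζ)^[n] f) ζ‖ < 1) {S : ℝ}
    (hS : ∀ n, ∑ k ∈ Finset.range n, ph (((npStep ζ)^[k] f) ζ) ≤ S) (r : ℝ) (hr : 0 ≤ r)
    (hr1 : r < 1) :
    ∫ t, -Real.log (Cara ν (Zr ζ r t)).re ∂lam ≤ S + 2 * Real.log ‖1 - ζ * f ζ‖ := by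
  rw [integral_log_reF h hf hr hr1]
  have h1 : ‖f ζ‖ < 1 := hs 0
  have u := upper h h0 hf.Sch hs hS hr hr1
  have m := integral_mono (int_ph_zf h hf.Sch hr hr1) (int_ph h hf.Sch h1 hr hr1) (fun t => by
    have z1 := Zr_lt h hr hr1 t
    have z2 := Sch_strict h hf.Sch h1 z1
    refine ph_mono ?_ z2
    rw [norm_mul]
    exact mul_le_of_le_one_left (norm_nonneg _) z1.le)
  linarith

theorem poisson_sum_rule_NP (ζ : ℂ) (hζ : ‖ζ‖ < 1) (hζ0 : ζ ≠ 0)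
    (ν : Measure ℝ) [IsProbabilityMeasure ν] (hcirc : ν (Ico 0 (2*π))ᶜ = 0)
    (hnt : InfiniteSupport ν) (f : ℂ → ℂ) (hf : IsSchurFn ν f) :
    KLdiv (PoisM ζ) ν =
      ENNReal.ofReal (-Real.log (1 - ‖mtrans (conj ζ) (f ζ)‖^2))
      + ∑' k : ℕ, ENNReal.ofReal (-Real.log (1 - ‖((npStep ζ)^[k+1] f) ζ‖^2)) := by
  have hs := strict_all hζ hζ0 ν hcirc hnt hf
  have h1 : ‖f ζ‖ < 1 := hs 0
  have ce := const_eq hζ h1 (one_sub_zf_ne hf.Sch hζ)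
  have c0 : 0 ≤ -Real.log (1 - ‖mtrans (conj ζ) (f ζ)‖^2) :=
    ph_nonneg (norm_mtrans_lt (by rwa [Complex.norm_conj]) h1)
  set c := -Real.log (1 - ‖mtrans (conj ζ) (f ζ)‖^2) with hc
  change _ = _ + ∑' k : ℕ, ENNReal.ofReal (ph (((npStep ζ)^[k+1] f) ζ))
  set a : ℕ → ℝ := fun k => ph (((npStep ζ)^[k+1] f) ζ) with ha
  have a0 : ∀ k, 0 ≤ a k := fun k => ph_nonneg (hs _)
  have hsum : ∀ n, ∑ k ∈ Finset.range (n+1), ph (((npStep ζ)^[k] f) ζ)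
      = ∑ k ∈ Finset.range n, a k + ph (f ζ) := fun n => by
    rw [Finset.sum_range_succ']; rfl
  have one : PoisM ζ ≪ ν → Integrable (llr (PoisM ζ) ν) (PoisM ζ) →
      ∀ n, ∑ k ∈ Finset.range n, a k ≤ ∫ θ, llr (PoisM ζ) ν θ ∂(PoisM ζ) - c := by
    intro hac hL n
    have := part_one hζ hζ0 ν hac hL hf hs (n+1)
    rw [hsum] at this
    linarith
  by_cases hA : Summable a
  · have hle : ∀ n, ∑ k ∈ Finset.range n, a k ≤ ∑' k, a k := fun n =>
      hA.sum_le_tsum _ fun k _ => a0 k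
    have hS : ∀ n, ∑ k ∈ Finset.range n, ph (((npStep ζ)^[k] f) ζ) ≤ ∑' k, a k + ph (f ζ) := by
      intro n
      have q := hsum n
      rw [Finset.sum_range_succ] at q
      have := ph_nonneg (hs n)
      have := hle n
      linarith
    obtain ⟨hac, hL, hle2⟩ := part_two hζ ν hcirc hf (hC_of hζ hζ0 ν hf hs hS)
    have hge : ∑' k, a k ≤ ∫ θ, llr (PoisM ζ) ν θ ∂(PoisM ζ) - c :=
      hA.tsum_le_of_sum_range_le (one hac hL)
    have heq : ∫ θ, llr (PoisM ζ) ν θ ∂(PoisM ζ) = c + ∑' k, a k := by linarith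
    unfold KLdiv
    rw [if_pos ⟨hac, hL⟩, heq, ENNReal.ofReal_add c0 (tsum_nonneg a0),
      ENNReal.ofReal_tsum_of_nonneg a0 hA]
  · have hT : ∑' k : ℕ, ENNReal.ofReal (a k) = ⊤ := by
      by_contra hne
      apply hA
      have := ENNReal.summable_toReal hne
      exact this.congr fun k => ENNReal.toReal_ofReal (a0 k)
    unfold KLdiv
    rw [if_neg, hT, add_top]
    rintro ⟨hac, hL⟩
    exact hA (summable_of_sum_range_le a0 (one hac hL))

end SumRules
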